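/- Let D ⊂ ℝ^d satisfy Assumption (D) with data (ε₀, η, n), and fix α ∈ (0,2) and β ∈ (0,1). There exists C > 0 such that for all x, x' ∈ ∂D, A ∈ I_x, A' ∈ I_{x'}, writing ρ = ρ(x,x',A,A'): (1) ∫∫_{(ℝ^d)²} ( min(|z|,1) + |y| min(|y−z|,1) / δ(x+Ay) ) · δ(x+Ay)^{α/2} / ( |z−y|^{d+α} |y|^{d} ) · 1_{{x+Ay ∈ D, x+Az ∉ D}} dy dz ≤ C; (2) ∫∫_{(ℝ^d)²} δ(x'+A'z)^{α/2} δ(x+Ay)^{α/2} / ( |z−y|^{d+α} |y|^{d} ) · 1_{{x+Ay ∈ D, x+Az ∉ D, x'+A'z ∈ D}} dy dz ≤ C ρ; (3) ∫_{ℍ} 1_{{x+Az ∉ D}} |z|^{−d−β} dz ≤ C; (4) ∫_{ℍ} 1_{{x+Az ∉ D, x'+A'z ∈ D}} |z|^{−d−β} dz ≤ C ρ; where ℍ = { z ∈ ℝ^d : z·e₁ > 0 } and all integrals are with respect to Lebesgue measure. -/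

import Mathlib

open Metric Set Bornology MeasureTheory
open scoped RealInnerProductSpace ENNReal Classical

noncomputable section

/-- The first vector of the canonical basis of `ℝ^d`. -/
def e1 (d : ℕ) : EuclideanSpace ℝ (Fin d) :=
  if h : 0 < d then EuclideanSpace.single (⟨0, h⟩ : Fin d) 1 else 0

/-- The projection `ℝ^d → ℝ^{d−1}`, `u ↦ (u·e₂, …, u·e_d)`. -/
def projTail (d : ℕ) (u : EuclideanSpace ℝ (Fin d)) :
    EuclideanSpace ℝ (Fin (d - 1)) :=
  (EuclideanSpace.equiv (Fin (d - 1)) ℝ).symm fun i => u ⟨i.1 + 1, by have := i.isLt; omega⟩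

/-- Assumption (D): `D ⊂ ℝ^d` (`d ≥ 2`) is nonempty, open, bounded and convex, `n x` is a
unit vector for `x ∈ ∂D`, and around each boundary point `x` the domain is, in suitable
isometric coordinates sending `e₁` to `n x`, the epigraph of a `C³` uniformly strongly
convex function `ψ` with `ψ(0)=0`, `∇ψ(0)=0`, `Hess ψ ≥ η`, `‖D²ψ‖+‖D³ψ‖ ≤ η⁻¹`. -/
structure AssumptionD (d : ℕ) (D : Set (EuclideanSpace ℝ (Fin d))) (ε₀ η : ℝ)
    (n : EuclideanSpace ℝ (Fin d) → EuclideanSpace ℝ (Fin d)) : Prop where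
  dim_ge : 2 ≤ d
  eps_pos : 0 < ε₀
  eps_lt_one : ε₀ < 1
  eta_pos : 0 < η
  nonempty : D.Nonempty
  isOpen : IsOpen D
  isBounded : Bornology.IsBounded D
  convex : Convex ℝ D
  normal_norm : ∀ x ∈ frontier D, ‖n x‖ = 1
  chart : ∀ x ∈ frontier D,
    ∃ A₀ : EuclideanSpace ℝ (Fin d) →ₗᵢ[ℝ] EuclideanSpace ℝ (Fin d),
      A₀ (e1 d) = n x ∧
      ∃ ψ : EuclideanSpace ℝ (Fin (d - 1)) → ℝ,
        ContDiffOn ℝ 3 ψ (Metric.ball (0 : EuclideanSpace ℝ (Fin (d - 1))) ε₀) ∧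
        (∀ v ∈ Metric.ball (0 : EuclideanSpace ℝ (Fin (d - 1))) ε₀, 0 ≤ ψ v) ∧
        ψ 0 = 0 ∧
        fderiv ℝ ψ 0 = 0 ∧
        (∀ v ∈ Metric.ball (0 : EuclideanSpace ℝ (Fin (d - 1))) ε₀,
          ∀ w : EuclideanSpace ℝ (Fin (d - 1)),
            η * ‖w‖ ^ 2 ≤ iteratedFDeriv ℝ 2 ψ v ![w, w]) ∧
        (∀ v ∈ Metric.ball (0 : EuclideanSpace ℝ (Fin (d - 1))) ε₀,
          ‖iteratedFDeriv ℝ 2 ψ v‖ + ‖iteratedFDeriv ℝ 3 ψ v‖ ≤ η⁻¹) ∧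
        D ∩ Metric.ball x ε₀ =
          (fun u : EuclideanSpace ℝ (Fin d) => x + A₀ u) ''
            {u : EuclideanSpace ℝ (Fin d) |
              u ∈ Metric.ball (0 : EuclideanSpace ℝ (Fin d)) ε₀ ∧
              ψ (projTail d u) < ⟪u, e1 d⟫}


lemma dy_general {X : Type*} [MeasurableSpace X] (μ : Measure X) (S : Set X) (hS : MeasurableSet S)
    (f : X → ℝ) (hf : Measurable f) (w : X → ℝ≥0∞) (M τ a b q : ℝ) (hM : 0 ≤ M) (hτ : 0 < τ)
    (ha : 0 ≤ a) (hq : 0 < q) (hqab : q ^ (b - a) < 1)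
    (hbound : ∀ k : ℕ, ∫⁻ x in S ∩ {x | f x < τ * q ^ k}, w x ∂μ
      ≤ ENNReal.ofReal (M * (τ * q ^ k) ^ b))
    (hcov : ∀ x ∈ S, ∃ k : ℕ, τ * q ^ k / 2 ≤ f x ∧ f x < τ * q ^ k) :
    ∫⁻ x in S, ENNReal.ofReal (f x ^ (-a)) * w x ∂μ
      ≤ ENNReal.ofReal (2 ^ a / (1 - q ^ (b - a)) * M * τ ^ (b - a)) := by
  set P : ℕ → Set X := fun k => S ∩ {x | τ * q ^ k / 2 ≤ f x ∧ f x < τ * q ^ k} with hP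
  have hPm : ∀ k, MeasurableSet (P k) := fun k =>
    hS.inter ((measurableSet_le measurable_const hf).inter (measurableSet_lt hf measurable_const))
  have hsub : S ⊆ ⋃ k, P k := by
    intro x hx
    obtain ⟨k, hk⟩ := hcov x hx
    exact mem_iUnion.2 ⟨k, hx, hk⟩
  have hpiece : ∀ k, ∫⁻ x in P k, ENNReal.ofReal (f x ^ (-a)) * w x ∂μ
      ≤ ENNReal.ofReal (2 ^ a * M * τ ^ (b - a) * (q ^ (b - a)) ^ k) := by
    intro k
    have hs : 0 < τ * q ^ k := by positivity
    calc ∫⁻ x in P k, ENNReal.ofReal (f x ^ (-a)) * w x ∂μ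
        ≤ ∫⁻ x in P k, ENNReal.ofReal ((τ * q ^ k / 2) ^ (-a)) * w x ∂μ := by
          apply setLIntegral_mono' (hPm k)
          intro x hx
          gcongr ENNReal.ofReal ?_ * _
          exact Real.rpow_le_rpow_of_nonpos (by positivity) hx.2.1 (by linarith)
      _ = ENNReal.ofReal ((τ * q ^ k / 2) ^ (-a)) * ∫⁻ x in P k, w x ∂μ :=
          lintegral_const_mul' _ _ ENNReal.ofReal_ne_top
      _ ≤ ENNReal.ofReal ((τ * q ^ k / 2) ^ (-a)) * ENNReal.ofReal (M * (τ * q ^ k) ^ b) := by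
          gcongr
          refine le_trans (lintegral_mono_set ?_) (hbound k)
          exact fun x hx => ⟨hx.1, hx.2.2⟩
      _ = _ := by
          rw [← ENNReal.ofReal_mul (by positivity)]
          congr 1
          rw [Real.div_rpow hs.le (by norm_num), Real.rpow_neg (by norm_num : (0:ℝ) ≤ 2)]
          have h1 : (τ * q ^ k) ^ (-a) * (τ * q ^ k) ^ b = τ ^ (b - a) * (q ^ (b - a)) ^ k := by
            rw [← Real.rpow_add hs, show -a + b = b - a by ring, Real.mul_rpow hτ.le (by positivity),
              ← Real.rpow_natCast, ← Real.rpow_natCast, ← Real.rpow_mul hq.le, ← Real.rpow_mul hq.le,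
              mul_comm (k : ℝ)]
          rw [div_inv_eq_mul]
          linear_combination (2 ^ a * M) * h1
  have hq0 : 0 ≤ q ^ (b - a) := by positivity
  calc ∫⁻ x in S, ENNReal.ofReal (f x ^ (-a)) * w x ∂μ
      ≤ ∫⁻ x in ⋃ k, P k, ENNReal.ofReal (f x ^ (-a)) * w x ∂μ := lintegral_mono_set hsub
    _ ≤ ∑' k, ∫⁻ x in P k, ENNReal.ofReal (f x ^ (-a)) * w x ∂μ := lintegral_iUnion_le _ _
    _ ≤ ∑' k, ENNReal.ofReal (2 ^ a * M * τ ^ (b - a) * (q ^ (b - a)) ^ k) :=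
        ENNReal.tsum_le_tsum hpiece
    _ = ENNReal.ofReal (∑' k : ℕ, (2 ^ a * M * τ ^ (b - a) * (q ^ (b - a)) ^ k)) := by
        rw [ENNReal.ofReal_tsum_of_nonneg]
        · intro k; positivity
        · exact (summable_geometric_of_lt_one hq0 hqab).mul_left _
    _ = _ := by
        rw [tsum_mul_left, tsum_geometric_of_lt_one hq0 hqab]
        congr 1
        ring

lemma dy_small {X : Type*} [MeasurableSpace X] (μ : Measure X) (S : Set X) (hS : MeasurableSet S)
    (f : X → ℝ) (hf : Measurable f) (w : X → ℝ≥0∞) (M τ a b : ℝ) (hM : 0 ≤ M) (hτ : 0 < τ)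
    (ha : 0 ≤ a) (hab : a < b)
    (hbound : ∀ s : ℝ, 0 < s → s ≤ τ → ∫⁻ x in S ∩ {x | f x < s}, w x ∂μ
      ≤ ENNReal.ofReal (M * s ^ b))
    (hcov : ∀ x ∈ S, 0 < f x ∧ f x < τ) :
    ∫⁻ x in S, ENNReal.ofReal (f x ^ (-a)) * w x ∂μ
      ≤ ENNReal.ofReal (2 ^ a / (1 - (1/2 : ℝ) ^ (b - a)) * M * τ ^ (b - a)) := by
  apply dy_general μ S hS f hf w M τ a b (1/2) hM hτ ha (by norm_num)
  · exact Real.rpow_lt_one (by norm_num) (by norm_num) (by linarith)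
  · intro k
    apply hbound _ (by positivity)
    have : (1/2 : ℝ) ^ k ≤ 1 := pow_le_one₀ (by norm_num) (by norm_num)
    nlinarith
  · intro x hx
    obtain ⟨h0, h1⟩ := hcov x hx
    have hex : ∃ k : ℕ, τ * (1/2 : ℝ) ^ k / 2 ≤ f x := by
      obtain ⟨k, hk⟩ := exists_pow_lt_of_lt_one (div_pos h0 hτ) (by norm_num : (1/2 : ℝ) < 1)
      refine ⟨k, ?_⟩
      rw [lt_div_iff₀ hτ] at hk
      have : 0 < (1/2 : ℝ) ^ k * τ := by positivity
      linarith
    refine ⟨Nat.find hex, Nat.find_spec hex, ?_⟩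
    rcases h : Nat.find hex with _ | m
    · simpa using h1
    · have := Nat.find_min hex (m := m) (by omega)
      rw [not_le] at this
      rw [pow_succ]
      linarith

lemma dy_large {X : Type*} [MeasurableSpace X] (μ : Measure X) (S : Set X) (hS : MeasurableSet S)
    (f : X → ℝ) (hf : Measurable f) (w : X → ℝ≥0∞) (M τ a b : ℝ) (hM : 0 ≤ M) (hτ : 0 < τ)
    (ha : 0 ≤ a) (hab : b < a)
    (hbound : ∀ s : ℝ, 0 < s → ∫⁻ x in S ∩ {x | f x < s}, w x ∂μ
      ≤ ENNReal.ofReal (M * s ^ b))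
    (hcov : ∀ x ∈ S, τ ≤ f x) :
    ∫⁻ x in S, ENNReal.ofReal (f x ^ (-a)) * w x ∂μ
      ≤ ENNReal.ofReal (2 ^ a / (1 - (2 : ℝ) ^ (b - a)) * M * (2 * τ) ^ (b - a)) := by
  apply dy_general μ S hS f hf w M (2 * τ) a b 2 hM (by positivity) ha (by norm_num)
  · exact Real.rpow_lt_one_of_one_lt_of_neg (by norm_num) (by linarith)
  · intro k
    exact hbound _ (by positivity)
  · intro x hx
    obtain ⟨k, h1, h2⟩ := exists_nat_pow_near ((one_le_div hτ).2 (hcov x hx)) (by norm_num : (1:ℝ) < 2)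
    refine ⟨k, ?_, ?_⟩
    · rw [le_div_iff₀ hτ] at h1; linarith
    · rw [div_lt_iff₀ hτ, pow_succ] at h2; linarith

/-- inner layer -/
lemma layer_in {E : Type*} [NormedAddCommGroup E] [NormedSpace ℝ E] [FiniteDimensional ℝ E]
    [MeasurableSpace E] [BorelSpace E] (μ : Measure E) [μ.IsAddHaarMeasure]
    (U : Set E) (hU : IsOpen U) (hc : Convex ℝ U) (hne : Uᶜ.Nonempty) (hfin : μ U ≠ ⊤) (c : E) (r t : ℝ)
    (hr : 0 < r) (ht : 0 < t) (hd : 1 ≤ Module.finrank ℝ E)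
    (hb : ball c r ⊆ U) :
    μ {y | y ∈ U ∧ infDist y Uᶜ < t} ≤ ENNReal.ofReal (Module.finrank ℝ E * (t / r)) * μ U := by
  set d := Module.finrank ℝ E
  rcases le_or_gt r t with h | h
  · calc μ {y | y ∈ U ∧ infDist y Uᶜ < t} ≤ μ U := measure_mono (fun y hy => hy.1)
      _ = 1 * μ U := (one_mul _).symm
      _ ≤ _ := by
        gcongr
        rw [ENNReal.one_le_ofReal]
        have h1 : 1 ≤ t / r := (one_le_div hr).2 h
        have h2 : (1:ℝ) ≤ d := by exact_mod_cast hd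
        nlinarith
  · set l := t / r with hl
    have hl0 : 0 < l := by positivity
    have hl1 : l < 1 := (div_lt_one hr).2 h
    set V := AffineMap.homothety c (1 - l) '' U with hV
    have hVsub : V ⊆ U ∩ {y | t ≤ infDist y Uᶜ} := by
      rintro _ ⟨u, hu, rfl⟩
      have key : ball (AffineMap.homothety c (1 - l) u) t ⊆ U := by
        intro p hp
        rw [AffineMap.homothety_apply, vsub_eq_sub, vadd_eq_add] at hp
        rw [mem_ball, dist_eq_norm] at hp
        have h1 : c + (1 / l) • (p - ((1 - l) • (u - c) + c)) ∈ U := by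
          apply hb
          rw [mem_ball, dist_eq_norm, add_sub_cancel_left, norm_smul, Real.norm_of_nonneg (by positivity),
            one_div, inv_mul_lt_iff₀ hl0, hl, div_mul_cancel₀ _ hr.ne']
          exact hp
        have h2 := hc hu h1 (sub_nonneg.2 hl1.le) hl0.le (by ring)
        convert h2 using 1
        rw [smul_add, smul_smul, mul_one_div_cancel hl0.ne']
        module
      refine ⟨key (mem_ball_self ht), ?_⟩
      rw [mem_ofPred_eq, le_infDist hne]
      intro y hy
      by_contra hcon
      exact hy (key (by rw [mem_ball, dist_comm]; linarith))
    have hVm : MeasurableSet V := by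
      have : IsOpen V := (AffineMap.homothety_isOpenMap c (1 - l) (by linarith)) U hU
      exact this.measurableSet
    have hVmu : μ V = ENNReal.ofReal ((1 - l) ^ d) * μ U := by
      rw [hV, Measure.addHaar_image_homothety, abs_of_nonneg (pow_nonneg (by linarith) _)]
    calc μ {y | y ∈ U ∧ infDist y Uᶜ < t} ≤ μ (U \ V) := by
          apply measure_mono
          rintro y ⟨h1, h2⟩
          exact ⟨h1, fun hy => not_le.2 h2 (hVsub hy).2⟩
      _ = μ U - μ V := measure_sdiff (fun y hy => (hVsub hy).1) hVm.nullMeasurableSet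
          (ne_top_of_le_ne_top hfin (measure_mono (fun y hy => (hVsub hy).1)))
      _ ≤ _ := by
          rw [hVmu, tsub_le_iff_right, ← add_mul]
          calc μ U = 1 * μ U := (one_mul _).symm
            _ ≤ _ := by
              gcongr
              rw [← ENNReal.ofReal_add (by positivity) (pow_nonneg (by linarith) _), ENNReal.one_le_ofReal]
              have := one_add_mul_le_pow (a := -l) (by linarith) d
              rw [← sub_eq_add_neg] at this
              linarith

lemma layer_out {E : Type*} [NormedAddCommGroup E] [NormedSpace ℝ E] [FiniteDimensional ℝ E]
    [MeasurableSpace E] [BorelSpace E] (μ : Measure E) [μ.IsAddHaarMeasure]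
    (U : Set E) (hU : IsOpen U) (hc : Convex ℝ U) (hfin : μ U ≠ ⊤) (c : E) (r t : ℝ)
    (hr : 0 < r) (ht : 0 < t) (htr : t ≤ r)
    (hb : ball c r ⊆ U) :
    μ {z | z ∉ U ∧ ∃ y ∈ U, dist z y < t} ≤
      ENNReal.ofReal (2 ^ Module.finrank ℝ E * (t / r)) * μ U := by
  set d := Module.finrank ℝ E
  set l := t / r with hl
  have hl0 : 0 < l := by positivity
  have hl1 : l ≤ 1 := (div_le_one hr).2 htr
  set V := AffineMap.homothety c (1 + l) '' U with hV
  have hVmu : μ V = ENNReal.ofReal ((1 + l) ^ d) * μ U := by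
    rw [hV, Measure.addHaar_image_homothety, abs_of_nonneg (pow_nonneg (by linarith) _)]
  have hUV : ∀ z, (∃ y ∈ U, dist z y < t) → z ∈ V := by
    rintro z ⟨y, hy, hzy⟩
    have h1 : c + (1 / l) • (z - y) ∈ U := by
      apply hb
      rw [mem_ball, dist_eq_norm, add_sub_cancel_left, norm_smul, Real.norm_of_nonneg (by positivity),
            one_div, inv_mul_lt_iff₀ hl0, hl, div_mul_cancel₀ _ hr.ne', ← dist_eq_norm]
      exact hzy
    have h2 := hc hy h1 (a := 1 / (1 + l)) (b := l / (1 + l)) (by positivity) (by positivity)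
      (by field_simp)
    refine ⟨_, h2, ?_⟩
    rw [AffineMap.homothety_apply, vsub_eq_sub, vadd_eq_add]
    have h3 : (1 + l) ≠ 0 := by positivity
    rw [smul_sub, smul_add, smul_smul, smul_smul, smul_add, smul_smul, mul_one_div_cancel h3,
      mul_div_cancel₀ _ h3, mul_one_div_cancel hl0.ne']
    module
  calc μ {z | z ∉ U ∧ ∃ y ∈ U, dist z y < t} ≤ μ (V \ U) := by
        apply measure_mono
        rintro z ⟨h1, h2⟩
        exact ⟨hUV z h2, h1⟩
    _ = μ V - μ U := measure_sdiff (fun y hy => hUV y ⟨y, hy, by simpa using ht⟩)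
          hU.measurableSet.nullMeasurableSet hfin
    _ ≤ _ := by
        rw [hVmu, tsub_le_iff_right]
        calc _ ≤ (ENNReal.ofReal (2 ^ d * l) + 1) * μ U := by
              gcongr
              rw [← ENNReal.ofReal_one, ← ENNReal.ofReal_add (by positivity) zero_le_one]
              apply ENNReal.ofReal_le_ofReal
              have hk : ∀ k : ℕ, (1 + l) ^ k ≤ (2 ^ k - 1) * l + 1 := by
                intro k
                induction k with
                | zero => simp
                | succ k ih =>
                  rw [pow_succ, pow_succ]
                  have h1 : (1:ℝ) ≤ 2 ^ k := one_le_pow₀ (by norm_num)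
                  have h2 : (1 + l) ^ k * (1 + l) ≤ ((2 ^ k - 1) * l + 1) * (1 + l) := by gcongr
                  have h3 : (2 ^ k - 1) * l * l ≤ (2 ^ k - 1) * l * 1 :=
                    mul_le_mul_of_nonneg_left hl1 (mul_nonneg (by linarith) hl0.le)
                  nlinarith
              have := hk d
              linarith
          _ = _ := by ring


/-- convex open sets with inner and outer radius, and with the origin on the boundary -/
structure GoodSet {d : ℕ} (U : Set (EuclideanSpace ℝ (Fin d))) (r R : ℝ) : Prop where
  op : IsOpen U
  conv : Convex ℝ U
  sub : U ⊆ ball 0 R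
  hr : 0 < r
  hrR : r ≤ R
  inb : ∃ c, ball c r ⊆ U
  zc : (0 : EuclideanSpace ℝ (Fin d)) ∈ closure U
  z0 : (0 : EuclideanSpace ℝ (Fin d)) ∉ U

def kap (d : ℕ) : ℝ := (volume (ball (0 : EuclideanSpace ℝ (Fin d)) 1)).toReal

lemma kap_nonneg (d : ℕ) : 0 ≤ kap d := ENNReal.toReal_nonneg

lemma vol_ball {d : ℕ} (c : EuclideanSpace ℝ (Fin d)) (s : ℝ) (hs : 0 < s) :
    volume (ball c s) = ENNReal.ofReal (kap d * s ^ (d : ℝ)) := by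
  rw [Measure.addHaar_ball_of_pos _ _ hs, finrank_euclideanSpace_fin, Real.rpow_natCast, mul_comm,
    ENNReal.ofReal_mul (kap_nonneg d), kap, ENNReal.ofReal_toReal measure_ball_lt_top.ne]

namespace GoodSet
variable {d : ℕ} {U : Set (EuclideanSpace ℝ (Fin d))} {r R : ℝ}

lemma hR (h : GoodSet U r R) : 0 < R := h.hr.trans_le h.hrR

lemma smallball (h : GoodSet U r R) {s : ℝ} (hs : 0 < s) (hsR : s ≤ R) :
    ∃ c, ball c (s / (2 * R) * r) ⊆ U ∩ ball 0 s := by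
  obtain ⟨c, hc⟩ := h.inb
  have hR := h.hR
  set l := s / (2 * R) with hl
  have hl0 : 0 < l := by positivity
  have hl1 : l < 1 := by rw [hl, div_lt_one (by positivity)]; linarith
  refine ⟨l • c, fun p hp => ?_⟩
  have h1 : l⁻¹ • p ∈ ball c r := by
    rw [mem_ball, dist_eq_norm] at hp ⊢
    have : l⁻¹ • p - c = l⁻¹ • (p - l • c) := by rw [smul_sub, inv_smul_smul₀ hl0.ne']
    rw [this, norm_smul, Real.norm_of_nonneg (by positivity), inv_mul_lt_iff₀ hl0]
    exact hp
  have h2 := hc h1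
  constructor
  · have := h.conv.openSegment_closure_interior_subset_interior h.zc (h.op.interior_eq.symm ▸ h2)
    rw [h.op.interior_eq] at this
    apply this
    refine ⟨1 - l, l, by linarith, hl0, by ring, ?_⟩
    rw [smul_zero, zero_add, smul_inv_smul₀ hl0.ne']
  · have := h.sub h2
    rw [mem_ball_zero_iff, norm_smul, Real.norm_of_nonneg (by positivity), inv_mul_lt_iff₀ hl0] at this
    rw [mem_ball_zero_iff]
    have h3 : l * R = s / 2 := by rw [hl]; field_simp
    linarith

lemma layer_in (h : GoodSet U r R) (hd : 1 ≤ d) {s t : ℝ} (hs : 0 < s) (hsR : s ≤ R) (ht : 0 < t) :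
    volume {y | y ∈ U ∧ ‖y‖ < s ∧ infDist y Uᶜ < t} ≤
      ENNReal.ofReal (d * (2 * R / r) * kap d * s ^ ((d : ℝ) - 1) * t) := by
  obtain ⟨c, hc⟩ := h.smallball hs hsR
  have hR := h.hR
  have hr := h.hr
  have hne : (U ∩ ball 0 s)ᶜ.Nonempty := ⟨0, fun hh => h.z0 hh.1⟩
  have hne' : (Uᶜ).Nonempty := ⟨0, h.z0⟩
  have h1 := _root_.layer_in volume (U ∩ ball 0 s) (h.op.inter isOpen_ball)
    (h.conv.inter (convex_ball _ _)) hne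
    (ne_top_of_le_ne_top measure_ball_lt_top.ne (measure_mono inter_subset_right)) c _ t
    (by positivity) ht (by simpa using hd) hc
  calc _ ≤ _ := measure_mono ?_
    _ ≤ _ := h1
    _ ≤ ENNReal.ofReal (d * (t / (s / (2 * R) * r))) * ENNReal.ofReal (kap d * s ^ (d : ℝ)) := by
      rw [← vol_ball 0 s hs, finrank_euclideanSpace_fin]
      gcongr
      exact inter_subset_right
    _ = _ := by
      rw [← ENNReal.ofReal_mul (by positivity), Real.rpow_sub_one hs.ne']
      congr 1
      field_simp
  rintro y ⟨hy, hys, hyt⟩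
  refine ⟨⟨hy, mem_ball_zero_iff.2 hys⟩, lt_of_le_of_lt ?_ hyt⟩
  exact infDist_le_infDist_of_subset (compl_subset_compl.2 inter_subset_left) hne'

lemma layer_out (h : GoodSet U r R) {s t : ℝ} (hs : 0 < s) (hsR : s ≤ R) (ht : 0 < t) :
    volume {z | z ∉ U ∧ ‖z‖ < s ∧ infDist z U < t} ≤
      ENNReal.ofReal (2 ^ d * 2 ^ d * (2 * R / r) * kap d * s ^ ((d : ℝ) - 1) * t) := by
  have hR := h.hR
  have hr := h.hr
  have hrR := h.hrR
  have hk := kap_nonneg d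
  have h2d : (1:ℝ) ≤ 2 ^ d := one_le_pow₀ (by norm_num)
  have hne : U.Nonempty := by
    obtain ⟨c, hc⟩ := h.inb
    exact ⟨c, hc (mem_ball_self hr)⟩
  rcases le_or_gt t (s / (2 * R) * r) with htr | htr
  · obtain ⟨c, hc⟩ := h.smallball hs hsR
    have hc' : ball c (s / (2 * R) * r) ⊆ U ∩ ball 0 (2 * s) :=
      hc.trans (inter_subset_inter_right _ (ball_subset_ball (by linarith)))
    have hts : t ≤ s := by
      refine htr.trans ?_
      rw [div_mul_eq_mul_div, div_le_iff₀ (by positivity)]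
      nlinarith
    have h1 := _root_.layer_out volume (U ∩ ball 0 (2 * s)) (h.op.inter isOpen_ball)
      (h.conv.inter (convex_ball _ _))
      (ne_top_of_le_ne_top measure_ball_lt_top.ne (measure_mono inter_subset_right)) c _ t
      (by positivity) ht htr hc'
    calc _ ≤ _ := measure_mono ?_
      _ ≤ _ := h1
      _ ≤ ENNReal.ofReal (2 ^ d * (t / (s / (2 * R) * r))) *
            ENNReal.ofReal (kap d * (2 * s) ^ (d : ℝ)) := by
        rw [← vol_ball 0 (2 * s) (by linarith), finrank_euclideanSpace_fin]
        gcongr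
        exact inter_subset_right
      _ = _ := by
        rw [← ENNReal.ofReal_mul (by positivity), Real.rpow_sub_one hs.ne',
          Real.mul_rpow (by norm_num) hs.le, Real.rpow_natCast 2 d]
        congr 1
        field_simp
    rintro z ⟨hz, hzs, hzt⟩
    obtain ⟨y, hy, hzy⟩ := (infDist_lt_iff hne).1 hzt
    refine ⟨fun hh => hz hh.1, y, ⟨hy, ?_⟩, hzy⟩
    rw [mem_ball_zero_iff]
    have : ‖y‖ ≤ ‖z‖ + dist z y := by
      rw [dist_eq_norm, ← norm_neg (z - y)]
      calc ‖y‖ = ‖z + -(z - y)‖ := by congr 1; abel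
        _ ≤ _ := norm_add_le _ _
    linarith
  · calc _ ≤ volume (ball (0 : EuclideanSpace ℝ (Fin d)) s) :=
          measure_mono (fun z hz => mem_ball_zero_iff.2 hz.2.1)
      _ ≤ _ := by
        rw [vol_ball _ _ hs]
        apply ENNReal.ofReal_le_ofReal
        have e : s ^ (d : ℝ) = s ^ ((d : ℝ) - 1) * s := by
          rw [Real.rpow_sub_one hs.ne']; field_simp
        rw [e]
        have h3 : s ≤ (2 * R / r) * t := by
          rw [div_mul_eq_mul_div, div_lt_iff₀ (by positivity)] at htr
          rw [div_mul_eq_mul_div, le_div_iff₀ hr]; linarith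
        have h4 : (1:ℝ) ≤ 2 ^ d * 2 ^ d := by nlinarith
        calc kap d * (s ^ ((d : ℝ) - 1) * s)
            ≤ kap d * (s ^ ((d : ℝ) - 1) * ((2 * R / r) * t)) := by gcongr
          _ = 1 * (kap d * (s ^ ((d : ℝ) - 1) * ((2 * R / r) * t))) := by ring
          _ ≤ (2 ^ d * 2 ^ d) * (kap d * (s ^ ((d : ℝ) - 1) * ((2 * R / r) * t))) := by
            gcongr
          _ = _ := by ring

lemma del_pos (h : GoodSet U r R) {y} (hy : y ∈ U) : 0 < infDist y Uᶜ := by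
  have hne' : (Uᶜ).Nonempty := ⟨0, h.z0⟩
  rw [← h.op.isClosed_compl.notMem_iff_infDist_pos hne']
  exact fun hh => hh hy

lemma del_le (_h : GoodSet U r R) {y z} (hz : z ∉ U) : infDist y Uᶜ ≤ ‖z - y‖ := by
  rw [← dist_eq_norm, dist_comm]
  exact infDist_le_dist_of_mem hz

lemma del_le' (h : GoodSet U r R) {y} : infDist y Uᶜ ≤ ‖y‖ := by
  simpa using h.del_le (y := y) h.z0

lemma norm_pos (h : GoodSet U r R) {y} (hy : y ∈ U) : 0 < ‖y‖ :=
  (h.del_pos hy).trans_le h.del_le'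

lemma out_le (h : GoodSet U r R) {z} : infDist z U ≤ ‖z‖ := by
  rw [← infDist_closure, ← dist_zero_right]
  exact infDist_le_dist_of_mem h.zc

end GoodSet

lemma K_lemma (d : ℕ) (hd : 1 ≤ d) (r R p : ℝ) (hp : 0 ≤ p) (hp1 : p < 1) :
    ∃ C : ℝ, 0 < C ∧ ∀ U : Set (EuclideanSpace ℝ (Fin d)), GoodSet U r R →
      ∫⁻ y in U, ENNReal.ofReal (‖y‖ ^ (-((d : ℝ) - 1))) * ENNReal.ofReal (infDist y Uᶜ ^ (-p)) ≤
        ENNReal.ofReal C := by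
  set M1 := d * (2 * R / r) * kap d with hM1
  set M2 := 2 ^ p / (1 - (1/2 : ℝ) ^ (1 - p)) * M1 with hM2
  set C := 2 ^ ((d : ℝ) - 1) / (1 - (1/2 : ℝ) ^ ((d : ℝ) - p - ((d : ℝ) - 1))) * M2 *
    R ^ ((d : ℝ) - p - ((d : ℝ) - 1))
  refine ⟨|C| + 1, by positivity, fun U h => ?_⟩
  have hR := h.hR
  have hr := h.hr
  have hk := kap_nonneg d
  have hd' : (1:ℝ) ≤ d := by exact_mod_cast hd
  have hM10 : 0 ≤ M1 := by positivity
  have hh : (1/2 : ℝ) ^ (1 - p) < 1 := Real.rpow_lt_one (by norm_num) (by norm_num) (by linarith)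
  have hM20 : 0 ≤ M2 := mul_nonneg (div_nonneg (by positivity) (by linarith)) hM10
  have inner : ∀ s : ℝ, 0 < s → s ≤ R →
      ∫⁻ y in U ∩ {y | ‖y‖ < s}, ENNReal.ofReal (infDist y Uᶜ ^ (-p)) ≤
        ENNReal.ofReal (M2 * s ^ ((d : ℝ) - p)) := by
    intro s hs hsR
    have := dy_small volume (U ∩ {y | ‖y‖ < s})
      (h.op.measurableSet.inter (measurableSet_lt measurable_norm measurable_const))
      (fun y => infDist y Uᶜ) (continuous_infDist_pt _).measurable (fun _ => 1)
      (M1 * s ^ ((d : ℝ) - 1)) s p 1 (by positivity) hs hp hp1 ?_ ?_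
    · simp only [mul_one] at this
      refine this.trans (le_of_eq ?_)
      congr 1
      rw [show (d : ℝ) - p = ((d : ℝ) - 1) + (1 - p) by ring, Real.rpow_add hs, hM2]
      ring
    · intro t ht hts
      rw [setLIntegral_one, Real.rpow_one]
      refine le_trans (measure_mono ?_) (h.layer_in hd hs hsR ht)
      exact fun y hy => ⟨hy.1.1, hy.1.2, hy.2⟩
    · intro y hy
      exact ⟨h.del_pos hy.1, h.del_le'.trans_lt hy.2⟩
  refine (dy_small volume U h.op.measurableSet (fun y => ‖y‖) measurable_norm _ M2 R ((d : ℝ) - 1)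
    ((d : ℝ) - p) hM20 hR (by linarith) (by linarith) inner ?_).trans ?_
  · intro y hy
    exact ⟨h.norm_pos hy, mem_ball_zero_iff.1 (h.sub hy)⟩
  · apply ENNReal.ofReal_le_ofReal
    have := le_abs_self C
    linarith

lemma tail_lemma (d : ℕ) (a : ℝ) (ha : (d : ℝ) < a) :
    ∃ C : ℝ, 0 < C ∧ ∀ (y : EuclideanSpace ℝ (Fin d)) (τ : ℝ), 0 < τ →
      ∫⁻ z in {z | τ ≤ ‖z - y‖}, ENNReal.ofReal (‖z - y‖ ^ (-a)) ≤
        ENNReal.ofReal (C * τ ^ ((d : ℝ) - a)) := by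
  set C := 2 ^ a / (1 - (2 : ℝ) ^ ((d : ℝ) - a)) * kap d * 2 ^ ((d : ℝ) - a) with hC
  refine ⟨|C| + 1, by positivity, fun y τ hτ => ?_⟩
  have hk := kap_nonneg d
  have hd0 : (0:ℝ) ≤ d := by positivity
  have := dy_large volume {z | τ ≤ ‖z - y‖}
      (measurableSet_le measurable_const (by fun_prop))
      (fun z => ‖z - y‖) (by fun_prop) (fun _ => 1)
      (kap d) τ a d hk hτ (by linarith) ha ?_ ?_
  · simp only [mul_one] at this
    refine this.trans (ENNReal.ofReal_le_ofReal ?_)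
    rw [Real.mul_rpow (by norm_num) hτ.le, ← mul_assoc]
    gcongr
    have := le_abs_self C
    linarith
  · intro s hs
    rw [setLIntegral_one, ← vol_ball y s hs]
    apply measure_mono
    intro z hz
    rw [mem_ball, dist_eq_norm]
    exact hz.2
  · intro z hz; exact hz

lemma near_lemma (d : ℕ) (a : ℝ) (ha0 : 0 ≤ a) (ha : a < (d : ℝ)) :
    ∃ C : ℝ, 0 < C ∧ ∀ (τ : ℝ), 0 < τ →
      ∫⁻ z in {z : EuclideanSpace ℝ (Fin d) | 0 < ‖z‖ ∧ ‖z‖ < τ}, ENNReal.ofReal (‖z‖ ^ (-a)) ≤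
        ENNReal.ofReal (C * τ ^ ((d : ℝ) - a)) := by
  set C := 2 ^ a / (1 - (1/2 : ℝ) ^ ((d : ℝ) - a)) * kap d with hC
  refine ⟨|C| + 1, by positivity, fun τ hτ => ?_⟩
  have hk := kap_nonneg d
  have := dy_small volume {z : EuclideanSpace ℝ (Fin d) | 0 < ‖z‖ ∧ ‖z‖ < τ}
      ((measurableSet_lt measurable_const measurable_norm).inter
        (measurableSet_lt measurable_norm measurable_const))
      (fun z => ‖z‖) (by fun_prop) (fun _ => 1)
      (kap d) τ a d hk hτ ha0 ha ?_ ?_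
  · simp only [mul_one] at this
    refine this.trans (ENNReal.ofReal_le_ofReal ?_)
    gcongr
    have := le_abs_self C
    linarith
  · intro s hs hsτ
    rw [setLIntegral_one, ← vol_ball 0 s hs]
    apply measure_mono
    intro z hz
    rw [mem_ball_zero_iff]
    exact hz.2
  · intro z hz; exact hz


lemma pointwise1 (d α γ Y w δ Z : ℝ) (hα : 0 < α) (hγ0 : 0 < γ) (hγ : γ < 1) (hδ : 0 < δ)
    (hY : δ ≤ Y) (hw : δ ≤ w) (hZ0 : 0 ≤ Z) (hZ : Z ≤ Y + w) :
    (min Z 1 + Y * min w 1 / δ) * δ ^ (α / 2) / (w ^ (d + α) * Y ^ d) ≤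
      3 * (Y ^ (-(d - 1)) * δ ^ (α / 2 - 1)) * w ^ (-(d + α - γ)) := by
  have hY0 : 0 < Y := hδ.trans_le hY
  have hw0 : 0 < w := hδ.trans_le hw
  have hmin : ∀ Z : ℝ, 0 ≤ Z → min Z 1 ≤ Z ^ γ := by
    intro Z hZ
    rcases le_or_gt Z 1 with h | h
    · exact (min_le_left _ _).trans (Real.self_le_rpow_of_le_one hZ h hγ.le)
    · exact (min_le_right _ _).trans (Real.one_le_rpow h.le hγ0.le)
  have h1 : min Z 1 ≤ Y ^ γ + w ^ γ :=
    (hmin Z hZ0).trans ((Real.rpow_le_rpow hZ0 hZ hγ0.le).trans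
      (Real.rpow_add_le_add_rpow hY0.le hw0.le hγ0.le hγ.le))
  have hwg : 0 < w ^ γ := Real.rpow_pos_of_pos hw0 _
  have h2 : Y ^ γ ≤ Y * w ^ γ / δ := by
    have e1 : Y ^ γ = Y * Y ^ (γ - 1) := by
      rw [Real.rpow_sub_one hY0.ne']; field_simp
    have e2 : Y ^ (γ - 1) ≤ δ ^ (γ - 1) := Real.rpow_le_rpow_of_nonpos hδ hY (by linarith)
    have e3 : δ ^ (γ - 1) = δ ^ γ / δ := Real.rpow_sub_one hδ.ne' _
    have e4 : δ ^ γ ≤ w ^ γ := Real.rpow_le_rpow hδ.le hw hγ0.le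
    calc Y ^ γ = Y * Y ^ (γ - 1) := e1
      _ ≤ Y * (w ^ γ / δ) := by
        gcongr
        rw [e3] at e2
        exact e2.trans (by gcongr)
      _ = _ := by ring
  have h3 : w ^ γ ≤ Y * w ^ γ / δ := by
    rw [le_div_iff₀ hδ]; nlinarith
  have h4 : Y * min w 1 / δ ≤ Y * w ^ γ / δ := by
    gcongr
    exact hmin w hw0.le
  calc (min Z 1 + Y * min w 1 / δ) * δ ^ (α / 2) / (w ^ (d + α) * Y ^ d)
      ≤ (3 * (Y * w ^ γ / δ)) * δ ^ (α / 2) / (w ^ (d + α) * Y ^ d) := by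
        gcongr
        linarith
    _ = _ := by
      rw [neg_sub, Real.rpow_sub hY0, Real.rpow_one, Real.rpow_sub_one hδ.ne', neg_sub,
        Real.rpow_sub hw0]
      field_simp

lemma part1 (d : ℕ) (hd : 2 ≤ d) (r R α : ℝ) (hα : 0 < α) (hα2 : α < 2) :
    ∃ C : ℝ, 0 < C ∧ ∀ U : Set (EuclideanSpace ℝ (Fin d)), GoodSet U r R →
      ∫⁻ y : EuclideanSpace ℝ (Fin d), ∫⁻ z : EuclideanSpace ℝ (Fin d),
        ENNReal.ofReal (if y ∈ U ∧ z ∉ U then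
              (min ‖z‖ 1 + ‖y‖ * min ‖y - z‖ 1 / infDist y Uᶜ) *
                infDist y Uᶜ ^ (α / 2) / (‖z - y‖ ^ ((d : ℝ) + α) * ‖y‖ ^ (d : ℝ))
              else 0) ≤ ENNReal.ofReal C := by
  obtain ⟨γ, hγ1, hγ2⟩ : ∃ γ, α / 2 < γ ∧ γ < min α 1 :=
    exists_between (lt_min (by linarith) (by linarith))
  have hγα := lt_of_lt_of_le hγ2 (min_le_left _ _)
  have hγ3 := lt_of_lt_of_le hγ2 (min_le_right _ _)
  obtain ⟨CT, hCT, hT⟩ := tail_lemma d (d + α - γ) (by linarith)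
  obtain ⟨CK, hCK, hK⟩ := K_lemma d (by omega) r R (1 + α / 2 - γ) (by linarith) (by linarith)
  refine ⟨3 * CT * CK, by positivity, fun U h => ?_⟩
  have inner : ∀ y, ∫⁻ z : EuclideanSpace ℝ (Fin d),
        ENNReal.ofReal (if y ∈ U ∧ z ∉ U then
              (min ‖z‖ 1 + ‖y‖ * min ‖y - z‖ 1 / infDist y Uᶜ) *
                infDist y Uᶜ ^ (α / 2) / (‖z - y‖ ^ ((d : ℝ) + α) * ‖y‖ ^ (d : ℝ))
              else 0) ≤
      U.indicator (fun y => ENNReal.ofReal (3 * CT) * (ENNReal.ofReal (‖y‖ ^ (-((d : ℝ) - 1))) *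
        ENNReal.ofReal (infDist y Uᶜ ^ (-(1 + α / 2 - γ))))) y := by
    intro y
    by_cases hy : y ∈ U
    · rw [indicator_of_mem hy]
      have hδ := h.del_pos hy
      set δ := infDist y Uᶜ with hδdef
      calc _ ≤ ∫⁻ z, {z | δ ≤ ‖z - y‖}.indicator (fun z =>
              ENNReal.ofReal (3 * (‖y‖ ^ (-((d:ℝ) - 1)) * δ ^ (α / 2 - 1))) *
                ENNReal.ofReal (‖z - y‖ ^ (-(d + α - γ)))) z := by
            apply lintegral_mono
            intro z
            by_cases hz : z ∈ U
            · simp [hz]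
            · have hzy : δ ≤ ‖z - y‖ := h.del_le hz
              rw [indicator_of_mem (by exact hzy)]
              simp only [hy, hz, not_false_eq_true, and_self, if_true]
              rw [← ENNReal.ofReal_mul (by positivity), norm_sub_rev y z]
              apply ENNReal.ofReal_le_ofReal
              refine pointwise1 d α γ ‖y‖ ‖z - y‖ δ ‖z‖ hα (by linarith) hγ3 hδ h.del_le' hzy
                (norm_nonneg _) ?_
              calc ‖z‖ = ‖y + (z - y)‖ := by congr 1; abel
                _ ≤ _ := norm_add_le _ _
        _ = ENNReal.ofReal (3 * (‖y‖ ^ (-((d:ℝ) - 1)) * δ ^ (α / 2 - 1))) *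
              ∫⁻ z in {z | δ ≤ ‖z - y‖}, ENNReal.ofReal (‖z - y‖ ^ (-(d + α - γ))) := by
            rw [lintegral_indicator (measurableSet_le measurable_const (by fun_prop)),
              lintegral_const_mul' _ _ ENNReal.ofReal_ne_top]
        _ ≤ ENNReal.ofReal (3 * (‖y‖ ^ (-((d:ℝ) - 1)) * δ ^ (α / 2 - 1))) *
              ENNReal.ofReal (CT * δ ^ ((d:ℝ) - (d + α - γ))) := by
            gcongr
            exact hT y δ hδ
        _ = _ := by
            rw [← ENNReal.ofReal_mul (by positivity), ← ENNReal.ofReal_mul (by positivity),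
              ← ENNReal.ofReal_mul (by positivity)]
            congr 1
            rw [show -(1 + α / 2 - γ) = (α / 2 - 1) + ((d:ℝ) - (d + α - γ)) by ring,
              Real.rpow_add hδ]
            ring
    · simp [hy]
  calc _ ≤ ∫⁻ y, U.indicator (fun y => ENNReal.ofReal (3 * CT) *
        (ENNReal.ofReal (‖y‖ ^ (-((d : ℝ) - 1))) *
        ENNReal.ofReal (infDist y Uᶜ ^ (-(1 + α / 2 - γ))))) y := lintegral_mono inner
    _ = ENNReal.ofReal (3 * CT) * ∫⁻ y in U, (ENNReal.ofReal (‖y‖ ^ (-((d : ℝ) - 1))) *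
        ENNReal.ofReal (infDist y Uᶜ ^ (-(1 + α / 2 - γ)))) := by
      rw [lintegral_indicator h.op.measurableSet, lintegral_const_mul' _ _ ENNReal.ofReal_ne_top]
    _ ≤ ENNReal.ofReal (3 * CT) * ENNReal.ofReal CK := by gcongr; exact hK U h
    _ = _ := by rw [← ENNReal.ofReal_mul (by positivity)]

lemma vol_W {d : ℕ} (hd : 1 ≤ d) {r R : ℝ} {U' U : Set (EuclideanSpace ℝ (Fin d))}
    (h' : GoodSet U' r R) {K : ℝ} (hK : 0 < K)
    (hg : ∀ z ∈ U', z ∉ U → infDist z U'ᶜ ≤ K * ‖z‖ ^ 2) {s : ℝ} (hs : 0 < s) (hsR : s ≤ R) :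
    volume ((U' \ U) ∩ {z | ‖z‖ < s}) ≤
      ENNReal.ofReal (2 * (d * (2 * R / r) * kap d) * s ^ ((d : ℝ) - 1) * (K * s ^ 2)) := by
  refine (measure_mono ?_).trans ((h'.layer_in hd hs hsR (t := 2 * (K * s ^ 2))
    (by positivity)).trans (le_of_eq ?_))
  · rintro z ⟨⟨hz', hz⟩, hzs⟩
    refine ⟨hz', hzs, (hg z hz' hz).trans_lt ?_⟩
    have : ‖z‖ ^ 2 ≤ s ^ 2 := pow_le_pow_left₀ (norm_nonneg _) (le_of_lt hzs) 2
    have h3 : 0 < K * s ^ 2 := by positivity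
    nlinarith
  · congr 1; ring

lemma part4 (d : ℕ) (hd : 2 ≤ d) (r R β : ℝ) (hβ : 0 < β) (hβ1 : β < 1) :
    ∃ C : ℝ, 0 < C ∧ ∀ U U' : Set (EuclideanSpace ℝ (Fin d)), GoodSet U r R → GoodSet U' r R →
      ∀ K : ℝ, 0 < K → (∀ z ∈ U', z ∉ U → infDist z U'ᶜ ≤ K * ‖z‖ ^ 2) →
      ∫⁻ z in U' \ U, ENNReal.ofReal (‖z‖ ^ (-(d + β))) ≤ ENNReal.ofReal (C * K) := by
  set M1 := 2 * (d * (2 * R / r) * kap d) with hM1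
  set C := 2 ^ (d + β) / (1 - (1/2 : ℝ) ^ ((d : ℝ) + 1 - (d + β))) * M1 *
    R ^ ((d : ℝ) + 1 - (d + β)) with hC
  refine ⟨|C| + 1, by positivity, fun U U' h h' K hK hg => ?_⟩
  have hR := h.hR
  have hr := h.hr
  have hk := kap_nonneg d
  have := dy_small volume (U' \ U) (h'.op.measurableSet.diff h.op.measurableSet)
      (fun z => ‖z‖) measurable_norm (fun _ => 1)
      (M1 * K) R (d + β) (d + 1) (by positivity) hR (by positivity) (by linarith) ?_ ?_
  · simp only [mul_one] at this
    refine this.trans (ENNReal.ofReal_le_ofReal ?_)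
    calc _ = C * K := by rw [hC]; ring
      _ ≤ _ := by
        gcongr
        have := le_abs_self C
        linarith
  · intro s hs hsR
    rw [setLIntegral_one]
    refine (vol_W (by omega) h' hK hg hs hsR).trans (le_of_eq ?_)
    congr 1
    rw [show (d:ℝ) + 1 = (d - 1) + (2 : ℕ) by push_cast; ring, Real.rpow_add hs,
      Real.rpow_natCast]
    ring
  · rintro z ⟨hz', hz⟩
    exact ⟨h'.norm_pos hz', mem_ball_zero_iff.1 (h'.sub hz')⟩


lemma halfball {d : ℕ} (e : EuclideanSpace ℝ (Fin d)) (he : ‖e‖ = 1) :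
    GoodSet ({z : EuclideanSpace ℝ (Fin d) | 0 < ⟪z, e⟫} ∩ ball 0 1) (1/4) 1 where
  op := (isOpen_lt continuous_const (by fun_prop)).inter isOpen_ball
  conv := by
    refine Convex.inter ?_ (convex_ball _ _)
    exact convex_halfSpace_gt (f := fun z : EuclideanSpace ℝ (Fin d) => ⟪z, e⟫)
      ⟨fun x y => inner_add_left x y e, fun c x => by simp [real_inner_smul_left]⟩ 0
  sub := inter_subset_right
  hr := by norm_num
  hrR := by norm_num
  inb := by
    refine ⟨(1/2 : ℝ) • e, fun z hz => ?_⟩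
    rw [mem_ball, dist_eq_norm] at hz
    set v := z - (1/2 : ℝ) • e with hv
    have hzv : z = v + (1/2 : ℝ) • e := by rw [hv]; abel
    have h1 : |⟪v, e⟫| ≤ ‖v‖ := by simpa [he] using abs_real_inner_le_norm v e
    constructor
    · show 0 < ⟪z, e⟫
      rw [hzv, inner_add_left, real_inner_smul_left, real_inner_self_eq_norm_sq, he]
      have := neg_le_of_abs_le h1
      linarith
    · rw [mem_ball_zero_iff, hzv]
      refine (norm_add_le _ _).trans_lt ?_
      rw [norm_smul, he]
      norm_num
      linarith
  zc := by
    rw [Metric.mem_closure_iff]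
    intro ε hε
    refine ⟨(min ε 1 / 2) • e, ⟨?_, ?_⟩, ?_⟩
    · show 0 < ⟪(min ε 1 / 2) • e, e⟫
      rw [real_inner_smul_left, real_inner_self_eq_norm_sq, he]
      have : 0 < min ε 1 := lt_min hε one_pos
      positivity
    · rw [mem_ball_zero_iff, norm_smul, he, Real.norm_of_nonneg (by positivity)]
      have := min_le_right ε 1
      linarith
    · rw [dist_comm, dist_zero_right, norm_smul, he, Real.norm_of_nonneg (by positivity)]
      have := min_le_left ε 1
      linarith
  z0 := by
    intro h
    have : (0:ℝ) < ⟪(0 : EuclideanSpace ℝ (Fin d)), e⟫ := h.1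
    simp at this

lemma part3 (d : ℕ) (hd : 2 ≤ d) (e : EuclideanSpace ℝ (Fin d)) (he : ‖e‖ = 1)
    (K β : ℝ) (hK : 0 < K) (hβ : 0 < β) (hβ1 : β < 1) :
    ∃ C : ℝ, 0 < C ∧ ∀ U : Set (EuclideanSpace ℝ (Fin d)), IsOpen U →
      (∀ z, z ∉ U → ⟪z, e⟫ ≤ K * ‖z‖ ^ 2) →
      ∫⁻ z in {z | 0 < ⟪z, e⟫} \ U, ENNReal.ofReal (‖z‖ ^ (-(d + β))) ≤ ENNReal.ofReal C := by
  set M1 := 2 * (d * (2 * 1 / (1/4)) * kap d) * K with hM1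
  set C := 2 ^ (d + β) / (1 - (1/2 : ℝ) ^ ((d : ℝ) + 1 - (d + β))) * M1 *
    1 ^ ((d : ℝ) + 1 - (d + β)) with hC
  obtain ⟨CT, hCT, hT⟩ := tail_lemma d (d + β) (by linarith)
  refine ⟨|C| + CT, by positivity, fun U hU hg => ?_⟩
  have hk := kap_nonneg d
  have hH : IsOpen {z : EuclideanSpace ℝ (Fin d) | 0 < ⟪z, e⟫} :=
    isOpen_lt continuous_const (by fun_prop)
  have hB := halfball e he
  have near := dy_small volume (({z | 0 < ⟪z, e⟫} \ U) ∩ {z | ‖z‖ < 1})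
      ((hH.measurableSet.diff hU.measurableSet).inter
        (measurableSet_lt measurable_norm measurable_const))
      (fun z => ‖z‖) measurable_norm (fun _ => 1)
      M1 1 (d + β) (d + 1) (by positivity) one_pos (by positivity) (by linarith) ?_ ?_
  · simp only [mul_one] at near
    calc _ ≤ ∫⁻ z in (({z | 0 < ⟪z, e⟫} \ U) ∩ {z | ‖z‖ < 1}) ∪ {z | 1 ≤ ‖z - 0‖},
            ENNReal.ofReal (‖z‖ ^ (-(d + β))) := by
          apply lintegral_mono_set
          intro z hz
          rcases lt_or_ge ‖z‖ 1 with h | h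
          · exact Or.inl ⟨hz, h⟩
          · right; simpa using h
      _ ≤ _ := lintegral_union_le _ _ _
      _ ≤ ENNReal.ofReal C + ENNReal.ofReal CT := by
          gcongr
          have := hT 0 1 one_pos
          simpa using this
      _ ≤ _ := by
          rw [ENNReal.ofReal_add (abs_nonneg _) hCT.le]
          gcongr
          exact le_abs_self C
  · intro s hs hsR
    rw [setLIntegral_one]
    have h2 := hB.layer_in (by omega) hs hsR (t := 2 * (K * s ^ 2)) (by positivity)
    refine (measure_mono ?_).trans (h2.trans (le_of_eq ?_))
    · rintro z ⟨⟨⟨hz0, hzU⟩, hz1⟩, hzs⟩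
      have hz0' : 0 < ⟪z, e⟫ := hz0
      refine ⟨⟨hz0, mem_ball_zero_iff.2 hz1⟩, hzs, ?_⟩
      have h3 : infDist z ({z : EuclideanSpace ℝ (Fin d) | 0 < ⟪z, e⟫} ∩ ball 0 1)ᶜ ≤ ⟪z, e⟫ := by
        have : z - ⟪z, e⟫ • e ∉ ({z : EuclideanSpace ℝ (Fin d) | 0 < ⟪z, e⟫} ∩ ball 0 1) := by
          rintro ⟨h, -⟩
          have h' : 0 < ⟪z - ⟪z, e⟫ • e, e⟫ := h
          rw [inner_sub_left, real_inner_smul_left, real_inner_self_eq_norm_sq, he] at h'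
          linarith
        refine (infDist_le_dist_of_mem this).trans (le_of_eq ?_)
        rw [dist_eq_norm, sub_sub_cancel, norm_smul, he, mul_one, Real.norm_of_nonneg hz0'.le]
      refine (h3.trans (hg z hzU)).trans_lt ?_
      have : ‖z‖ ^ 2 ≤ s ^ 2 := pow_le_pow_left₀ (norm_nonneg _) (le_of_lt hzs) 2
      have h3 : 0 < K * s ^ 2 := by positivity
      nlinarith
    · congr 1
      rw [show (d:ℝ) + 1 = (d - 1) + (2 : ℕ) by push_cast; ring, Real.rpow_add hs,
        Real.rpow_natCast]
      ring
  · rintro z ⟨⟨hz0, hzU⟩, hz1⟩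
    refine ⟨?_, hz1⟩
    rw [_root_.norm_pos_iff]
    rintro rfl
    simp at hz0

/-- inner estimate for (2) -/
lemma inner2 (d : ℕ) (hd : 2 ≤ d) (r R α : ℝ) (hα : 0 < α) (hα2 : α < 2) :
    ∃ C : ℝ, 0 < C ∧ ∀ U : Set (EuclideanSpace ℝ (Fin d)), GoodSet U r R →
      ∀ z, z ∉ U → 0 < infDist z U →
      ∫⁻ y in U, ENNReal.ofReal (infDist y Uᶜ ^ (α / 2) /
          (‖z - y‖ ^ ((d : ℝ) + α) * ‖y‖ ^ (d : ℝ)))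
        ≤ ENNReal.ofReal (C * (‖z‖ ^ (-(d : ℝ)) * infDist z U ^ (-(α / 2)))) := by
  have hd' : (2:ℝ) ≤ d := by exact_mod_cast hd
  obtain ⟨CT, hCT, hT⟩ := tail_lemma d (d + α / 2) (by linarith)
  obtain ⟨CN, hCN, hN⟩ := near_lemma d (d - α / 2) (by linarith) (by linarith)
  refine ⟨2 ^ (d : ℝ) * CT + 2 ^ (d + α / 2) * CN, by positivity, fun U h z hz hh => ?_⟩
  set hz' := infDist z U with hhz
  have hle : hz' ≤ ‖z‖ := h.out_le
  have hz0 : 0 < ‖z‖ := hh.trans_le hle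
  set S1 : Set (EuclideanSpace ℝ (Fin d)) := {y | hz' ≤ ‖y - z‖} with hS1
  set S2 : Set (EuclideanSpace ℝ (Fin d)) := {y | 0 < ‖y‖ ∧ ‖y‖ < ‖z‖ / 2} with hS2
  have hS1m : MeasurableSet S1 := measurableSet_le measurable_const (by fun_prop)
  have hS2m : MeasurableSet S2 := (measurableSet_lt measurable_const measurable_norm).inter
        (measurableSet_lt measurable_norm measurable_const)
  set F1 : EuclideanSpace ℝ (Fin d) → ℝ≥0∞ := fun y =>
    ENNReal.ofReal ((‖z‖ / 2) ^ (-(d : ℝ))) * ENNReal.ofReal (‖y - z‖ ^ (-((d:ℝ) + α / 2))) with hF1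
  set F2 : EuclideanSpace ℝ (Fin d) → ℝ≥0∞ := fun y =>
    ENNReal.ofReal ((‖z‖ / 2) ^ (-((d : ℝ) + α))) * ENNReal.ofReal (‖y‖ ^ (-((d:ℝ) - α / 2))) with hF2
  have hpt : ∀ y ∈ U, ENNReal.ofReal (infDist y Uᶜ ^ (α / 2) /
          (‖z - y‖ ^ ((d : ℝ) + α) * ‖y‖ ^ (d : ℝ))) ≤ S1.indicator F1 y + S2.indicator F2 y := by
    intro y hy
    have hδ := h.del_pos hy
    have hδ1 : infDist y Uᶜ ≤ ‖z - y‖ := h.del_le hz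
    have hδ2 : infDist y Uᶜ ≤ ‖y‖ := h.del_le'
    set δ := infDist y Uᶜ
    have hzy : 0 < ‖z - y‖ := hδ.trans_le hδ1
    have hy0 : 0 < ‖y‖ := hδ.trans_le hδ2
    rcases le_or_gt (‖z‖ / 2) ‖y‖ with hc | hc
    · have hm : y ∈ S1 := by
        show hz' ≤ ‖y - z‖
        rw [← dist_eq_norm, dist_comm]
        exact infDist_le_dist_of_mem hy
      refine le_trans ?_ le_self_add
      rw [indicator_of_mem hm, hF1]
      simp only
      rw [← ENNReal.ofReal_mul (by positivity), norm_sub_rev y z]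
      apply ENNReal.ofReal_le_ofReal
      calc δ ^ (α / 2) / (‖z - y‖ ^ ((d : ℝ) + α) * ‖y‖ ^ (d : ℝ))
          ≤ ‖z - y‖ ^ (α / 2) / (‖z - y‖ ^ ((d : ℝ) + α) * (‖z‖ / 2) ^ (d : ℝ)) := by
            gcongr
        _ = _ := by
            rw [Real.rpow_neg (by positivity),
              show -((d:ℝ) + α / 2) = α / 2 - (d + α) by ring, Real.rpow_sub hzy]
            field_simp
    · have hm : y ∈ S2 := ⟨hy0, hc⟩
      refine le_trans ?_ le_add_self
      rw [indicator_of_mem hm, hF2]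
      simp only
      rw [← ENNReal.ofReal_mul (by positivity)]
      apply ENNReal.ofReal_le_ofReal
      have hzy2 : ‖z‖ / 2 ≤ ‖z - y‖ := by
        have := norm_sub_norm_le z y
        linarith
      calc δ ^ (α / 2) / (‖z - y‖ ^ ((d : ℝ) + α) * ‖y‖ ^ (d : ℝ))
          ≤ ‖y‖ ^ (α / 2) / ((‖z‖ / 2) ^ ((d : ℝ) + α) * ‖y‖ ^ (d : ℝ)) := by
            gcongr
        _ = _ := by
            rw [Real.rpow_neg (by positivity),
              show -((d:ℝ) - α / 2) = α / 2 - d by ring, Real.rpow_sub hy0]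
            field_simp
  have hF1m : Measurable F1 := by
    simp only [hF1]; fun_prop
  calc _ ≤ ∫⁻ y in U, (S1.indicator F1 y + S2.indicator F2 y) :=
        setLIntegral_mono' h.op.measurableSet hpt
    _ ≤ ∫⁻ y, (S1.indicator F1 y + S2.indicator F2 y) := setLIntegral_le_lintegral _ _
    _ = (∫⁻ y in S1, F1 y) + ∫⁻ y in S2, F2 y := by
        rw [lintegral_add_left (hF1m.indicator hS1m), lintegral_indicator hS1m,
          lintegral_indicator hS2m]
    _ ≤ ENNReal.ofReal ((‖z‖ / 2) ^ (-(d : ℝ))) *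
          ENNReal.ofReal (CT * hz' ^ ((d:ℝ) - (d + α / 2))) +
        ENNReal.ofReal ((‖z‖ / 2) ^ (-((d : ℝ) + α))) *
          ENNReal.ofReal (CN * (‖z‖ / 2) ^ ((d:ℝ) - (d - α / 2))) := by
        rw [lintegral_const_mul' _ _ ENNReal.ofReal_ne_top,
          lintegral_const_mul' _ _ ENNReal.ofReal_ne_top]
        gcongr
        · exact hT z hz' hh
        · exact hN (‖z‖ / 2) (by positivity)
    _ ≤ _ := by
        rw [← ENNReal.ofReal_mul (by positivity), ← ENNReal.ofReal_mul (by positivity),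
          ← ENNReal.ofReal_add (by positivity) (by positivity)]
        apply ENNReal.ofReal_le_ofReal
        have e1 : (‖z‖ / 2) ^ (-(d : ℝ)) * (CT * hz' ^ ((d:ℝ) - (d + α / 2))) =
            2 ^ (d : ℝ) * CT * (‖z‖ ^ (-(d : ℝ)) * hz' ^ (-(α / 2))) := by
          rw [Real.div_rpow hz0.le (by norm_num), Real.rpow_neg (by norm_num : (0:ℝ) ≤ 2),
            div_inv_eq_mul, show (d:ℝ) - (d + α / 2) = -(α / 2) by ring]
          ring
        have e2 : (‖z‖ / 2) ^ (-((d : ℝ) + α)) * (CN * (‖z‖ / 2) ^ ((d:ℝ) - (d - α / 2))) =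
            2 ^ (d + α / 2) * CN * (‖z‖ ^ (-(d : ℝ)) * ‖z‖ ^ (-(α / 2))) := by
          rw [mul_left_comm, ← Real.rpow_add (by positivity),
            show -((d : ℝ) + α) + ((d:ℝ) - (d - α / 2)) = -(d + α / 2) by ring,
            Real.div_rpow hz0.le (by norm_num), Real.rpow_neg (by norm_num : (0:ℝ) ≤ 2),
            div_inv_eq_mul, neg_add, Real.rpow_add hz0]
          ring
        rw [e1, e2, add_mul]
        gcongr 2 ^ (d : ℝ) * CT * (‖z‖ ^ (-(d : ℝ)) * hz' ^ (-(α / 2))) +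
          2 ^ (d + α / 2) * CN * (‖z‖ ^ (-(d : ℝ)) * ?_)
        exact Real.rpow_le_rpow_of_nonpos hh hle (by linarith)


lemma outer2 (d : ℕ) (hd : 2 ≤ d) (r R α : ℝ) (hα : 0 < α) (hα2 : α < 2) :
    ∃ C : ℝ, 0 < C ∧ ∀ U U' : Set (EuclideanSpace ℝ (Fin d)), GoodSet U r R → GoodSet U' r R →
      ∀ K : ℝ, 0 < K → (∀ z ∈ U', z ∉ U → infDist z U'ᶜ ≤ K * ‖z‖ ^ 2) →
      ∫⁻ z in U' ∩ (closure U)ᶜ, ENNReal.ofReal (‖z‖ ^ (-((d : ℝ) - α))) *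
          ENNReal.ofReal (infDist z U ^ (-(α / 2)))
        ≤ ENNReal.ofReal (C * K ^ (1 - α / 2)) := by
  have hd' : (2:ℝ) ≤ d := by exact_mod_cast hd
  set M1 := 2 * (d * (2 * R / r) * kap d) with hM1
  set M2 := 2 ^ d * 2 ^ d * (2 * R / r) * kap d with hM2
  set M3 := 2 ^ (α / 2) / (1 - (1/2 : ℝ) ^ (1 - α / 2)) * M2 + M1 with hM3
  set C := 2 ^ ((d : ℝ) - α) / (1 - (1/2 : ℝ) ^ ((d : ℝ) + 1 - α - (d - α))) * M3 *
    R ^ ((d : ℝ) + 1 - α - (d - α)) with hC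
  refine ⟨|C| + 1, by positivity, fun U U' h h' K hK hg => ?_⟩
  have hR := h.hR
  have hr := h.hr
  have hk := kap_nonneg d
  have hUne : U.Nonempty := by
    obtain ⟨c, hc⟩ := h.inb
    exact ⟨c, hc (mem_ball_self hr)⟩
  have hh : (1/2 : ℝ) ^ (1 - α / 2) < 1 :=
    Real.rpow_lt_one (by norm_num) (by norm_num) (by linarith)
  have hM10 : 0 ≤ M1 := by positivity
  have hM20 : 0 ≤ M2 := by positivity
  have hc0 : 0 ≤ 2 ^ (α / 2) / (1 - (1/2 : ℝ) ^ (1 - α / 2)) :=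
    div_nonneg (by positivity) (by linarith)
  have hM30 : 0 ≤ M3 := add_nonneg (mul_nonneg hc0 hM20) hM10
  set W := U' ∩ (closure U)ᶜ with hW
  have hWm : MeasurableSet W := h'.op.measurableSet.inter isClosed_closure.isOpen_compl.measurableSet
  have hWU : ∀ z ∈ W, z ∉ U := fun z hz hzU => hz.2 (subset_closure hzU)
  have hWpos : ∀ z ∈ W, 0 < infDist z U := by
    intro z hz
    rw [← infDist_closure]
    rw [← isClosed_closure.notMem_iff_infDist_pos hUne.closure]
    exact hz.2
  have hinfm : Measurable (fun z => infDist z U) := (continuous_infDist_pt _).measurable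
  have inner : ∀ s : ℝ, 0 < s → s ≤ R →
      ∫⁻ z in W ∩ {z | ‖z‖ < s}, ENNReal.ofReal (infDist z U ^ (-(α / 2))) ≤
        ENNReal.ofReal (M3 * K ^ (1 - α / 2) * s ^ ((d : ℝ) + 1 - α)) := by
    intro s hs hsR
    set τ := K * s ^ 2 with hτ
    have hτ0 : 0 < τ := by positivity
    set S := W ∩ {z | ‖z‖ < s} with hS
    have hSm : MeasurableSet S := hWm.inter (measurableSet_lt measurable_norm measurable_const)
    have p1 := dy_small volume (S ∩ {z | infDist z U < τ})
      (hSm.inter (measurableSet_lt hinfm measurable_const))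
      (fun z => infDist z U) hinfm (fun _ => 1)
      (M2 * s ^ ((d : ℝ) - 1)) τ (α / 2) 1 (by positivity) hτ0 (by linarith) (by linarith) ?_ ?_
    · simp only [mul_one] at p1
      have p2 : ∫⁻ z in S ∩ {z | τ ≤ infDist z U}, ENNReal.ofReal (infDist z U ^ (-(α / 2))) ≤
          ENNReal.ofReal (τ ^ (-(α / 2))) * ENNReal.ofReal (M1 * s ^ ((d : ℝ) - 1) * τ) := by
        calc _ ≤ ∫⁻ z in S ∩ {z | τ ≤ infDist z U}, ENNReal.ofReal (τ ^ (-(α / 2))) := by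
              apply setLIntegral_mono' (hSm.inter (measurableSet_le measurable_const hinfm))
              intro z hz
              apply ENNReal.ofReal_le_ofReal
              exact Real.rpow_le_rpow_of_nonpos hτ0 hz.2 (by linarith)
          _ = ENNReal.ofReal (τ ^ (-(α / 2))) * volume (S ∩ {z | τ ≤ infDist z U}) :=
              setLIntegral_const _ _
          _ ≤ _ := by
              gcongr
              refine (measure_mono ?_).trans (vol_W (by omega) h' hK hg hs hsR)
              rintro z ⟨⟨hz, hzs⟩, -⟩
              exact ⟨⟨hz.1, hWU z hz⟩, hzs⟩
      calc _ ≤ ∫⁻ z in (S ∩ {z | infDist z U < τ}) ∪ (S ∩ {z | τ ≤ infDist z U}),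
            ENNReal.ofReal (infDist z U ^ (-(α / 2))) := by
            apply lintegral_mono_set
            intro z hz
            rcases lt_or_ge (infDist z U) τ with h | h
            · exact Or.inl ⟨hz, h⟩
            · exact Or.inr ⟨hz, h⟩
        _ ≤ _ := lintegral_union_le _ _ _
        _ ≤ _ := add_le_add p1 p2
        _ = _ := by
            rw [← ENNReal.ofReal_mul (by positivity), ← ENNReal.ofReal_add
              (by positivity) (by positivity)]
            congr 1
            have e1 : τ ^ (-(α / 2)) * τ = τ ^ (1 - α / 2) := by
              rw [sub_eq_add_neg, Real.rpow_add hτ0, Real.rpow_one, mul_comm]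
            have e2 : τ ^ (1 - α / 2) = K ^ (1 - α / 2) * s ^ (2 - α) := by
              rw [hτ, Real.mul_rpow hK.le (by positivity), ← Real.rpow_natCast s 2,
                ← Real.rpow_mul hs.le]
              congr 2
              push_cast; ring
            have e3 : s ^ ((d : ℝ) + 1 - α) = s ^ ((d : ℝ) - 1) * s ^ (2 - α) := by
              rw [← Real.rpow_add hs]; congr 1; ring
            rw [show τ ^ (-(α / 2)) * (M1 * s ^ ((d : ℝ) - 1) * τ) =
              M1 * s ^ ((d : ℝ) - 1) * (τ ^ (-(α / 2)) * τ) by ring, e1, e2, e3, hM3]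
            ring
    · intro t ht hts
      rw [setLIntegral_one, Real.rpow_one]
      refine le_trans (measure_mono ?_) (h.layer_out hs hsR ht)
      exact fun y hy => ⟨hWU y hy.1.1.1, hy.1.1.2, hy.2⟩
    · intro y hy
      exact ⟨hWpos y hy.1.1, hy.2⟩
  refine (dy_small volume W hWm (fun y => ‖y‖) measurable_norm _ (M3 * K ^ (1 - α / 2)) R
    ((d : ℝ) - α) ((d : ℝ) + 1 - α) (by positivity) hR (by linarith) (by linarith) inner ?_).trans ?_
  · intro y hy
    exact ⟨h'.norm_pos hy.1, mem_ball_zero_iff.1 (h'.sub hy.1)⟩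
  · apply ENNReal.ofReal_le_ofReal
    calc _ = C * K ^ (1 - α / 2) := by rw [hC]; ring
      _ ≤ _ := by
        gcongr
        have := le_abs_self C
        linarith

lemma part2 (d : ℕ) (hd : 2 ≤ d) (r R α : ℝ) (hα : 0 < α) (hα2 : α < 2) :
    ∃ C : ℝ, 0 < C ∧ ∀ U U' : Set (EuclideanSpace ℝ (Fin d)), GoodSet U r R → GoodSet U' r R →
      ∀ K : ℝ, 0 < K → (∀ z ∈ U', z ∉ U → infDist z U'ᶜ ≤ K * ‖z‖ ^ 2) →
      ∫⁻ y : EuclideanSpace ℝ (Fin d), ∫⁻ z : EuclideanSpace ℝ (Fin d),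
        ENNReal.ofReal (if y ∈ U ∧ z ∉ U ∧ z ∈ U' then
              infDist z U'ᶜ ^ (α / 2) *
                infDist y Uᶜ ^ (α / 2) / (‖z - y‖ ^ ((d : ℝ) + α) * ‖y‖ ^ (d : ℝ))
              else 0) ≤ ENNReal.ofReal (C * K) := by
  obtain ⟨C1, hC1, hI⟩ := inner2 d hd r R α hα hα2
  obtain ⟨C2, hC2, hO⟩ := outer2 d hd r R α hα hα2
  refine ⟨C1 * C2, by positivity, fun U U' h h' K hK hg => ?_⟩
  have hUne : U.Nonempty := by
    obtain ⟨c, hc⟩ := h.inb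
    exact ⟨c, hc (mem_ball_self h.hr)⟩
  set W := U' ∩ (closure U)ᶜ with hW
  have hWm : MeasurableSet W := h'.op.measurableSet.inter isClosed_closure.isOpen_compl.measurableSet
  have hmeas : Measurable (Function.uncurry fun (y z : EuclideanSpace ℝ (Fin d)) =>
      ENNReal.ofReal (if y ∈ U ∧ z ∉ U ∧ z ∈ U' then
              infDist z U'ᶜ ^ (α / 2) *
                infDist y Uᶜ ^ (α / 2) / (‖z - y‖ ^ ((d : ℝ) + α) * ‖y‖ ^ (d : ℝ))
              else 0)) := by
    apply ENNReal.measurable_ofReal.comp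
    apply Measurable.ite
    · exact (measurable_fst h.op.measurableSet).inter
        ((measurable_snd h.op.measurableSet).compl.inter (measurable_snd h'.op.measurableSet))
    · have m1 : Measurable (fun p : EuclideanSpace ℝ (Fin d) × EuclideanSpace ℝ (Fin d) =>
          infDist p.2 U'ᶜ) := (continuous_infDist_pt _).measurable.comp measurable_snd
      have m2 : Measurable (fun p : EuclideanSpace ℝ (Fin d) × EuclideanSpace ℝ (Fin d) =>
          infDist p.1 Uᶜ) := (continuous_infDist_pt _).measurable.comp measurable_fst
      fun_prop
    · exact measurable_const
  rw [lintegral_lintegral_swap hmeas.aemeasurable]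
  have hae : ∀ᵐ z : EuclideanSpace ℝ (Fin d), z ∉ frontier U :=
    measure_eq_zero_iff_ae_notMem.1 (h.conv.addHaar_frontier volume)
  calc _ ≤ ∫⁻ z, W.indicator (fun z => ENNReal.ofReal (C1 * K ^ (α / 2)) *
        (ENNReal.ofReal (‖z‖ ^ (-((d : ℝ) - α))) *
          ENNReal.ofReal (infDist z U ^ (-(α / 2))))) z := by
        apply lintegral_mono_ae
        filter_upwards [hae] with z hz
        by_cases hzU : z ∈ U
        · simp [hzU]
        by_cases hzU' : z ∈ U'
        swap
        · simp [hzU']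
        have hzc : z ∉ closure U := fun hh => hz ⟨hh, by rwa [h.op.interior_eq]⟩
        have hh : 0 < infDist z U := by
          rw [← infDist_closure, ← isClosed_closure.notMem_iff_infDist_pos hUne.closure]
          exact hzc
        have hδ := h'.del_pos hzU'
        have hn := h'.norm_pos hzU'
        rw [indicator_of_mem (show z ∈ W from ⟨hzU', hzc⟩)]
        calc _ = ∫⁻ y, U.indicator (fun y => ENNReal.ofReal (infDist z U'ᶜ ^ (α / 2)) *
                ENNReal.ofReal (infDist y Uᶜ ^ (α / 2) /
                (‖z - y‖ ^ ((d : ℝ) + α) * ‖y‖ ^ (d : ℝ)))) y := by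
              congr 1
              ext y
              by_cases hy : y ∈ U
              · rw [indicator_of_mem hy, ← ENNReal.ofReal_mul (by positivity)]
                simp only [hy, hzU, hzU', not_false_eq_true, and_self, if_true]
                rw [mul_div_assoc]
              · simp [hy]
          _ = ENNReal.ofReal (infDist z U'ᶜ ^ (α / 2)) *
              ∫⁻ y in U, ENNReal.ofReal (infDist y Uᶜ ^ (α / 2) /
                (‖z - y‖ ^ ((d : ℝ) + α) * ‖y‖ ^ (d : ℝ))) := by
              rw [lintegral_indicator h.op.measurableSet,
                lintegral_const_mul' _ _ ENNReal.ofReal_ne_top]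
          _ ≤ ENNReal.ofReal (K ^ (α / 2) * ‖z‖ ^ α) *
              ENNReal.ofReal (C1 * (‖z‖ ^ (-(d : ℝ)) * infDist z U ^ (-(α / 2)))) := by
              gcongr
              · calc infDist z U'ᶜ ^ (α / 2) ≤ (K * ‖z‖ ^ 2) ^ (α / 2) :=
                    Real.rpow_le_rpow hδ.le (hg z hzU' hzU) (by linarith)
                  _ = _ := by
                    rw [Real.mul_rpow hK.le (by positivity), ← Real.rpow_natCast ‖z‖ 2,
                      ← Real.rpow_mul hn.le]
                    congr 2
                    push_cast; ring
              · exact hI U h z hzU hh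
          _ = _ := by
              rw [← ENNReal.ofReal_mul (by positivity), ← ENNReal.ofReal_mul (by positivity),
                ← ENNReal.ofReal_mul (by positivity)]
              congr 1
              rw [show -((d : ℝ) - α) = α + -d by ring, Real.rpow_add hn]
              ring
    _ = ENNReal.ofReal (C1 * K ^ (α / 2)) * ∫⁻ z in W, (ENNReal.ofReal (‖z‖ ^ (-((d : ℝ) - α))) *
          ENNReal.ofReal (infDist z U ^ (-(α / 2)))) := by
        rw [lintegral_indicator hWm, lintegral_const_mul' _ _ ENNReal.ofReal_ne_top]
    _ ≤ ENNReal.ofReal (C1 * K ^ (α / 2)) * ENNReal.ofReal (C2 * K ^ (1 - α / 2)) := by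
        gcongr
        exact hO U U' h h' K hK hg
    _ = _ := by
        rw [← ENNReal.ofReal_mul (by positivity)]
        congr 1
        have : K ^ (α / 2) * K ^ (1 - α / 2) = K := by
          rw [← Real.rpow_add hK]; simp
        linear_combination (C1 * C2) * this


lemma e1_norm (d : ℕ) (hd : 2 ≤ d) : ‖e1 d‖ = 1 := by
  have h : 0 < d := by omega
  simp [e1, h]

lemma projTail_norm (d : ℕ) (hd : 2 ≤ d) (u : EuclideanSpace ℝ (Fin d)) :
    ‖projTail d u‖ ≤ ‖u‖ := by
  obtain ⟨m, rfl⟩ : ∃ m, d = m + 1 := ⟨d - 1, by omega⟩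
  rw [← sq_le_sq₀ (norm_nonneg _) (norm_nonneg _), EuclideanSpace.real_norm_sq_eq,
    EuclideanSpace.real_norm_sq_eq, Fin.sum_univ_succ]
  have : ∑ i : Fin (m + 1 - 1), (projTail (m + 1) u) i ^ 2 = ∑ i : Fin m, u i.succ ^ 2 := rfl
  rw [this]
  nlinarith [sq_nonneg (u 0)]

/-- the tail projection as a linear map -/
def projTailL (d : ℕ) (hd : 2 ≤ d) :
    EuclideanSpace ℝ (Fin d) →L[ℝ] EuclideanSpace ℝ (Fin (d - 1)) :=
  LinearMap.mkContinuous
    { toFun := projTail d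
      map_add' := by intro a b; rfl
      map_smul' := by intro a b; rfl } 1 (by
        intro u; rw [one_mul]; exact projTail_norm d hd u)

lemma projTailL_apply (d : ℕ) (hd : 2 ≤ d) (u : EuclideanSpace ℝ (Fin d)) :
    projTailL d hd u = projTail d u := rfl

lemma projTail_e1 (d : ℕ) (hd : 2 ≤ d) : projTail d (e1 d) = 0 := by
  have h : 0 < d := by omega
  ext i
  simp [projTail, e1, h]

/-- local defining function of the domain -/
structure GFun {d : ℕ} (D : Set (EuclideanSpace ℝ (Fin d))) (ε M : ℝ)
    (x nx : EuclideanSpace ℝ (Fin d)) (G : EuclideanSpace ℝ (Fin d) → ℝ)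
    (G' : EuclideanSpace ℝ (Fin d) → EuclideanSpace ℝ (Fin d) →L[ℝ] ℝ)
    (G'' : EuclideanSpace ℝ (Fin d) →
      EuclideanSpace ℝ (Fin d) →L[ℝ] EuclideanSpace ℝ (Fin d) →L[ℝ] ℝ) : Prop where
  d1 : ∀ w ∈ ball x ε, HasFDerivAt G (G' w) w
  d2 : ∀ w ∈ ball x ε, HasFDerivAt G' (G'' w) w
  b2 : ∀ w ∈ ball x ε, ‖G'' w‖ ≤ M
  l2 : ∀ w ∈ ball x ε, ∀ w' ∈ ball x ε, ‖G'' w - G'' w'‖ ≤ M * ‖w - w'‖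
  g0 : G x = 0
  g1 : ∀ v, G' x v = ⟪v, nx⟫
  mem : ∀ w ∈ ball x ε, (w ∈ D ↔ 0 < G w)
  tr : ∀ w (t : ℝ), G (w - t • nx) = G w - t
  le : ∀ w ∈ ball x ε, G w ≤ ⟪w - x, nx⟫

set_option maxSynthPendingDepth 5 in
lemma geoG {d : ℕ} {D : Set (EuclideanSpace ℝ (Fin d))} {ε₀ η : ℝ}
    {n : EuclideanSpace ℝ (Fin d) → EuclideanSpace ℝ (Fin d)}
    (hD : AssumptionD d D ε₀ η n) (x : EuclideanSpace ℝ (Fin d)) (hx : x ∈ frontier D) :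
    ∃ G G' G'', GFun D ε₀ η⁻¹ x (n x) G G' G'' := by
  have hd := hD.dim_ge
  have hn := hD.normal_norm x hx
  obtain ⟨A₀, hA, ψ, hψ, hψ0, hz, hfz, -, hb, hset⟩ := hD.chart x hx
  set Ae : EuclideanSpace ℝ (Fin d) ≃ₗᵢ[ℝ] EuclideanSpace ℝ (Fin d) := A₀.toLinearIsometryEquiv rfl with hAe
  have hAeA : ∀ u, Ae u = A₀ u := fun u => rfl
  set L : EuclideanSpace ℝ (Fin d) →L[ℝ] EuclideanSpace ℝ (Fin (d - 1)) := (projTailL d hd).comp (Ae.symm.toContinuousLinearEquiv : EuclideanSpace ℝ (Fin d) →L[ℝ] EuclideanSpace ℝ (Fin d)) with hL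
  have hLa : ∀ v, L v = projTail d (Ae.symm v) := fun v => rfl
  have hLn : ∀ v, ‖L v‖ ≤ ‖v‖ := fun v => by
    rw [hLa]; refine (projTail_norm d hd _).trans ?_
    rw [LinearIsometryEquiv.norm_map]
  have hLop : ‖L‖ ≤ 1 := ContinuousLinearMap.opNorm_le_bound _ zero_le_one
    (fun v => by rw [one_mul]; exact hLn v)
  have hsn : Ae.symm (n x) = e1 d := by
    rw [← hA, ← hAeA, LinearIsometryEquiv.symm_apply_apply]
  have hL0 : L (n x) = 0 := by rw [hLa, hsn, projTail_e1 d hd]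
  have hball : ∀ w ∈ ball x ε₀, L (w - x) ∈ ball (0 : EuclideanSpace ℝ (Fin (d - 1))) ε₀ := by
    intro w hw
    rw [mem_ball_zero_iff]; rw [mem_ball, dist_eq_norm] at hw
    exact (hLn _).trans_lt hw
  -- psi facts
  have hca : ∀ v ∈ ball (0 : EuclideanSpace ℝ (Fin (d - 1))) ε₀, ContDiffAt ℝ 3 ψ v := fun v hv =>
    hψ.contDiffAt (isOpen_ball.mem_nhds hv)
  have hca1 : ∀ v ∈ ball (0 : EuclideanSpace ℝ (Fin (d - 1))) ε₀, ContDiffAt ℝ 2 (fderiv ℝ ψ) v := fun v hv =>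
    (hca v hv).fderiv_right (by norm_num)
  have hca2 : ∀ v ∈ ball (0 : EuclideanSpace ℝ (Fin (d - 1))) ε₀, ContDiffAt ℝ 1 (fderiv ℝ (fderiv ℝ ψ)) v := fun v hv =>
    (hca1 v hv).fderiv_right (by norm_num)
  have hn2 : ∀ v, ‖fderiv ℝ (fderiv ℝ ψ) v‖ = ‖iteratedFDeriv ℝ 2 ψ v‖ := fun v => by
    rw [← norm_iteratedFDeriv_one, norm_iteratedFDeriv_fderiv]
  have hn3 : ∀ v, ‖fderiv ℝ (fderiv ℝ (fderiv ℝ ψ)) v‖ = ‖iteratedFDeriv ℝ 3 ψ v‖ := fun v => by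
    rw [← norm_iteratedFDeriv_one, norm_iteratedFDeriv_fderiv, norm_iteratedFDeriv_fderiv]
  have hlip : ∀ v ∈ ball (0 : EuclideanSpace ℝ (Fin (d - 1))) ε₀, ∀ v' ∈ ball (0 : EuclideanSpace ℝ (Fin (d - 1))) ε₀,
      ‖fderiv ℝ (fderiv ℝ ψ) v - fderiv ℝ (fderiv ℝ ψ) v'‖ ≤ η⁻¹ * ‖v - v'‖ := by
    intro v hv v' hv'
    refine Convex.norm_image_sub_le_of_norm_fderiv_le (𝕜 := ℝ) (s := ball (0 : EuclideanSpace ℝ (Fin (d - 1))) ε₀) ?_ ?_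
      (convex_ball _ _) hv' hv
    · intro y hy; exact (hca2 y hy).differentiableAt (by norm_num)
    · intro y hy; rw [hn3]
      linarith [hb y hy, norm_nonneg (iteratedFDeriv ℝ 2 ψ y)]
  have hinner : ∀ w, ⟪Ae.symm (w - x), e1 d⟫ = ⟪w - x, n x⟫ := by
    intro w
    rw [← hsn, LinearIsometryEquiv.inner_map_map]
  set P : (EuclideanSpace ℝ (Fin (d - 1)) →L[ℝ] ℝ) →L[ℝ] (EuclideanSpace ℝ (Fin d) →L[ℝ] ℝ) := (ContinuousLinearMap.compL ℝ (EuclideanSpace ℝ (Fin d)) (EuclideanSpace ℝ (Fin (d - 1))) ℝ).flip L with hP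
  have hPa : ∀ f, P f = f.comp L := fun f => rfl
  have hPop : ‖P‖ ≤ 1 := by
    refine ContinuousLinearMap.opNorm_le_bound _ zero_le_one (fun f => ?_)
    rw [hPa, one_mul]
    refine (ContinuousLinearMap.opNorm_comp_le _ _).trans ?_
    exact mul_le_of_le_one_right (norm_nonneg _) hLop
  have hPL : ∀ T : EuclideanSpace ℝ (Fin (d - 1)) →L[ℝ] EuclideanSpace ℝ (Fin (d - 1)) →L[ℝ] ℝ, ‖(P.comp T).comp L‖ ≤ ‖T‖ := by
    intro T
    refine (ContinuousLinearMap.opNorm_comp_le _ _).trans ?_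
    refine (mul_le_of_le_one_right (norm_nonneg _) hLop).trans ?_
    refine (ContinuousLinearMap.opNorm_comp_le _ _).trans ?_
    exact mul_le_of_le_one_left (norm_nonneg _) hPop
  have hsub : ∀ w, HasFDerivAt (fun w : EuclideanSpace ℝ (Fin d) => L (w - x)) L w := fun w => by
    exact L.hasFDerivAt.comp w ((hasFDerivAt_id w).sub_const x)
  refine ⟨fun w => ⟪n x, w - x⟫ - ψ (L (w - x)),
    fun w => innerSL ℝ (n x) - (fderiv ℝ ψ (L (w - x))).comp L,
    fun w => -((P.comp (fderiv ℝ (fderiv ℝ ψ) (L (w - x)))).comp L), ?_, ?_, ?_, ?_, ?_, ?_, ?_, ?_, ?_⟩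
  · intro w hw
    have h1 : HasFDerivAt (fun w : EuclideanSpace ℝ (Fin d) => ⟪n x, w - x⟫) (innerSL ℝ (n x)) w := by
      exact (innerSL ℝ (n x)).hasFDerivAt.comp w ((hasFDerivAt_id w).sub_const x)
    exact h1.sub ((((hca _ (hball w hw)).differentiableAt (by norm_num)).hasFDerivAt).comp w (hsub w))
  · intro w hw
    have h1 := (((hca1 _ (hball w hw)).differentiableAt (by norm_num)).hasFDerivAt).comp w (hsub w)
    have h2 := P.hasFDerivAt.comp w h1
    exact h2.const_sub (innerSL ℝ (n x))
  · intro w hw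
    rw [norm_neg]
    refine (hPL _).trans ?_
    rw [hn2]
    linarith [hb _ (hball w hw), norm_nonneg (iteratedFDeriv ℝ 3 ψ (L (w - x)))]
  · intro w hw w' hw'
    have : -((P.comp (fderiv ℝ (fderiv ℝ ψ) (L (w - x)))).comp L) -
      -((P.comp (fderiv ℝ (fderiv ℝ ψ) (L (w' - x)))).comp L) =
      -((P.comp (fderiv ℝ (fderiv ℝ ψ) (L (w - x)) - fderiv ℝ (fderiv ℝ ψ) (L (w' - x)))).comp L) := by
      rw [ContinuousLinearMap.comp_sub, ContinuousLinearMap.sub_comp]; abel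
    rw [this, norm_neg]
    refine (hPL _).trans ((hlip _ (hball w hw) _ (hball w' hw')).trans ?_)
    have : 0 ≤ η⁻¹ := (inv_pos.2 hD.eta_pos).le
    refine mul_le_mul_of_nonneg_left ?_ this
    rw [← map_sub]
    refine (hLn _).trans (le_of_eq ?_)
    congr 1; abel
  · simp [hz]
  · intro v
    simp [hfz, real_inner_comm]
  · intro w hw
    have h0 : w ∈ D ↔ w ∈ D ∩ ball x ε₀ := ⟨fun h => ⟨h, hw⟩, fun h => h.1⟩
    rw [h0, hset, sub_pos, real_inner_comm, ← hinner, hLa]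
    constructor
    · rintro ⟨u, ⟨hu, hlt⟩, rfl⟩
      have : Ae.symm ((fun u : EuclideanSpace ℝ (Fin d) => x + A₀ u) u - x) = u := by
        simp only [add_sub_cancel_left]
        rw [← hAeA, LinearIsometryEquiv.symm_apply_apply]
      rw [this]; exact hlt
    · intro h
      refine ⟨Ae.symm (w - x), ⟨?_, h⟩, ?_⟩
      · rw [mem_ball_zero_iff, LinearIsometryEquiv.norm_map, ← dist_eq_norm]; exact hw
      · simp only [← hAeA, LinearIsometryEquiv.apply_symm_apply]; abel
  · intro w t
    have : w - t • n x - x = (w - x) - t • n x := by abel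
    simp only [this]
    rw [map_sub, map_smul, hL0, smul_zero, sub_zero, inner_sub_right, inner_smul_right,
      real_inner_self_eq_norm_sq, hn]
    ring
  · intro w hw
    have := hψ0 _ (hball w hw)
    have h2 := real_inner_comm (n x) (w - x)
    linarith


lemma scalar_taylor (φ φ' φ'' : ℝ → ℝ) (K : ℝ)
    (h1 : ∀ t ∈ Icc (0 : ℝ) 1, HasDerivAt φ (φ' t) t)
    (h2 : ∀ t ∈ Icc (0 : ℝ) 1, HasDerivAt φ' (φ'' t) t)
    (hK : ∀ t ∈ Icc (0 : ℝ) 1, |φ'' t| ≤ K) (h0 : φ 0 = 0) (h0' : φ' 0 = 0) : |φ 1| ≤ K := by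
  have hK0 : 0 ≤ K := (abs_nonneg _).trans (hK 0 (by simp))
  have hA : ∀ t ∈ Icc (0 : ℝ) 1, |φ' t| ≤ K := by
    intro t ht
    have := norm_image_sub_le_of_norm_deriv_le_segment' (f := φ') (f' := φ'') (C := K)
      (a := 0) (b := 1) (fun s hs => (h2 s hs).hasDerivWithinAt)
      (fun s hs => hK s ⟨hs.1, hs.2.le⟩) t ht
    rw [h0', sub_zero, sub_zero, Real.norm_eq_abs] at this
    nlinarith [ht.1, ht.2]
  have := norm_image_sub_le_of_norm_deriv_le_segment' (f := φ) (f' := φ') (C := K)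
      (a := 0) (b := 1) (fun s hs => (h1 s hs).hasDerivWithinAt)
      (fun s hs => hA s ⟨hs.1, hs.2.le⟩) 1 (by simp)
  rw [h0, sub_zero, sub_zero, Real.norm_eq_abs, mul_one] at this
  exact this

lemma line_deriv {d : ℕ} (w v : EuclideanSpace ℝ (Fin d)) (t : ℝ) :
    HasDerivAt (fun t : ℝ => w + t • v) v t := by
  simpa using ((hasDerivAt_id t).smul_const v).const_add w

lemma GFun.line1 {d : ℕ} {D : Set (EuclideanSpace ℝ (Fin d))} {ε M : ℝ}
    {x nx : EuclideanSpace ℝ (Fin d)} {G G' G''} (hG : GFun D ε M x nx G G' G'')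
    (w v : EuclideanSpace ℝ (Fin d)) (t : ℝ) (h : w + t • v ∈ ball x ε) :
    HasDerivAt (fun t : ℝ => G (w + t • v)) (G' (w + t • v) v) t :=
  (hG.d1 _ h).comp_hasDerivAt t (line_deriv w v t)

lemma GFun.line2 {d : ℕ} {D : Set (EuclideanSpace ℝ (Fin d))} {ε M : ℝ}
    {x nx : EuclideanSpace ℝ (Fin d)} {G G' G''} (hG : GFun D ε M x nx G G' G'')
    (w v : EuclideanSpace ℝ (Fin d)) (t : ℝ) (h : w + t • v ∈ ball x ε) :
    HasDerivAt (fun t : ℝ => G' (w + t • v) v) (G'' (w + t • v) v v) t := by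
  have h1 : HasDerivAt (fun t : ℝ => G' (w + t • v)) (G'' (w + t • v) v) t :=
    (hG.d2 _ h).comp_hasDerivAt t (line_deriv w v t)
  have h2 := h1.clm_apply (hasDerivAt_const t v)
  simpa using h2

lemma support_pos {d : ℕ} {D : Set (EuclideanSpace ℝ (Fin d))} {ε₀ η : ℝ}
    {n : EuclideanSpace ℝ (Fin d) → EuclideanSpace ℝ (Fin d)}
    (hD : AssumptionD d D ε₀ η n) {x w : EuclideanSpace ℝ (Fin d)} (hx : x ∈ frontier D)
    (hw : w ∈ D) : 0 < ⟪w - x, n x⟫ := by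
  obtain ⟨G, G', G'', hG⟩ := geoG hD x hx
  have hε := hD.eps_pos
  have hε1 := hD.eps_lt_one
  have hN := norm_nonneg (w - x)
  set t : ℝ := ε₀ / (2 * (‖w - x‖ + 1)) with ht
  have ht0 : 0 < t := by positivity
  have ht1 : t ≤ 1 := by
    rw [ht, div_le_one (by positivity)]; linarith
  have hp : x + t • (w - x) ∈ interior D :=
    hD.convex.add_smul_sub_mem_interior' (frontier_subset_closure hx)
      (by rwa [hD.isOpen.interior_eq]) ⟨ht0, ht1⟩
  rw [hD.isOpen.interior_eq] at hp
  have hb : x + t • (w - x) ∈ ball x ε₀ := by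
    rw [mem_ball, dist_eq_norm, add_sub_cancel_left, norm_smul, Real.norm_eq_abs, abs_of_pos ht0,
      ht, div_mul_eq_mul_div, div_lt_iff₀ (by positivity)]
    nlinarith
  have h1 := (hG.mem _ hb).1 hp
  have h2 := hG.le _ hb
  rw [add_sub_cancel_left, inner_smul_left] at h2
  have h3 : 0 < t * ⟪w - x, n x⟫ := lt_of_lt_of_le h1 h2
  exact (pos_iff_pos_of_mul_pos h3).1 ht0

lemma inner_le_norm_unit {d : ℕ} (a b : EuclideanSpace ℝ (Fin d)) (hb : ‖b‖ = 1) :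
    ⟪a, b⟫ ≤ ‖a‖ := by
  simpa [hb] using real_inner_le_norm a b

lemma flat {d : ℕ} {D : Set (EuclideanSpace ℝ (Fin d))} {ε₀ η : ℝ}
    {n : EuclideanSpace ℝ (Fin d) → EuclideanSpace ℝ (Fin d)}
    (hD : AssumptionD d D ε₀ η n) {x w : EuclideanSpace ℝ (Fin d)} (hx : x ∈ frontier D)
    (hw : w ∉ D) : ⟪w - x, n x⟫ ≤ (1 / ε₀ + η⁻¹) * ‖w - x‖ ^ 2 := by
  obtain ⟨G, G', G'', hG⟩ := geoG hD x hx
  have hε := hD.eps_pos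
  have hη : 0 < η⁻¹ := inv_pos.2 hD.eta_pos
  have hN := norm_nonneg (w - x)
  have hle := inner_le_norm_unit (w - x) (n x) (hD.normal_norm x hx)
  rcases le_or_gt ε₀ ‖w - x‖ with h | h
  · have : ‖w - x‖ ≤ 1 / ε₀ * ‖w - x‖ ^ 2 := by
      rw [div_mul_eq_mul_div, le_div_iff₀ hε]; nlinarith
    nlinarith [sq_nonneg ‖w - x‖]
  · have hb : ∀ t ∈ Icc (0 : ℝ) 1, x + t • (w - x) ∈ ball x ε₀ := by
      intro t ht
      rw [mem_ball, dist_eq_norm, add_sub_cancel_left, norm_smul, Real.norm_eq_abs,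
        abs_of_nonneg ht.1]
      nlinarith [ht.2]
    have key := scalar_taylor (fun t => G (x + t • (w - x)) - t * ⟪w - x, n x⟫)
      (fun t => G' (x + t • (w - x)) (w - x) - ⟪w - x, n x⟫)
      (fun t => G'' (x + t • (w - x)) (w - x) (w - x)) (η⁻¹ * ‖w - x‖ ^ 2)
      (fun t ht => by
        have := (hG.line1 x (w - x) t (hb t ht)).sub
          ((hasDerivAt_id t).mul_const ⟪w - x, n x⟫)
        rw [one_mul] at this
        exact this)
      (fun t ht => (hG.line2 x (w - x) t (hb t ht)).sub_const _)
      (fun t ht => by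
        rw [← Real.norm_eq_abs]
        refine (ContinuousLinearMap.le_opNorm₂ _ _ _).trans ?_
        rw [mul_assoc, ← sq]
        exact mul_le_mul_of_nonneg_right (hG.b2 _ (hb t ht)) (sq_nonneg _))
      (by simp [hG.g0]) (by simp [hG.g1])
    have hwb : w ∈ ball x ε₀ := by rw [mem_ball, dist_eq_norm]; exact h
    have hGw : G w ≤ 0 := not_lt.1 (fun h => hw ((hG.mem w hwb).2 h))
    simp only [one_smul, add_sub_cancel, one_mul] at key
    have k2 := (abs_le.1 key).1
    have : 0 ≤ 1 / ε₀ * ‖w - x‖ ^ 2 := by positivity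
    nlinarith

lemma frontier_not_mem {d : ℕ} {D : Set (EuclideanSpace ℝ (Fin d))} (ho : IsOpen D)
    {x : EuclideanSpace ℝ (Fin d)} (hx : x ∈ frontier D) : x ∉ D := by
  rw [ho.frontier_eq] at hx; exact hx.2

lemma GFun.zero_frontier {d : ℕ} {D : Set (EuclideanSpace ℝ (Fin d))} {ε M : ℝ}
    {x nx : EuclideanSpace ℝ (Fin d)} {G G' G''} (hG : GFun D ε M x nx G G' G'')
    (ho : IsOpen D) {x' : EuclideanSpace ℝ (Fin d)} (hx' : x' ∈ frontier D)
    (hb : x' ∈ ball x ε) : G x' = 0 := by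
  refine le_antisymm (not_lt.1 fun h => frontier_not_mem ho hx' ((hG.mem _ hb).2 h)) ?_
  by_contra hlt
  push Not at hlt
  have hc : ContinuousAt G x' := (hG.d1 _ hb).continuousAt
  have h1 : ∀ᶠ w in nhds x', G w < 0 := hc.eventually_lt continuousAt_const hlt
  have h2 : ∀ᶠ w in nhds x', w ∈ ball x ε := isOpen_ball.mem_nhds hb
  have h3 := mem_closure_iff_frequently.1 (frontier_subset_closure hx')
  obtain ⟨w, hw, hw1, hw2⟩ := (h3.and_eventually (h1.and h2)).exists
  have := (hG.mem _ hw2).1 hw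
  linarith

lemma GFun.grad_le {d : ℕ} {D : Set (EuclideanSpace ℝ (Fin d))} {ε₀ η : ℝ}
    {n : EuclideanSpace ℝ (Fin d) → EuclideanSpace ℝ (Fin d)}
    (hD : AssumptionD d D ε₀ η n) {M : ℝ}
    {x nx : EuclideanSpace ℝ (Fin d)} {G G' G''} (hG : GFun D ε₀ M x nx G G' G'')
    {x' : EuclideanSpace ℝ (Fin d)} (hx' : x' ∈ frontier D)
    (hb : x' ∈ ball x ε₀) (u : EuclideanSpace ℝ (Fin d)) (hu : ⟪u, n x'⟫ = 0) :
    G' x' u ≤ 0 := by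
  by_contra hlt
  push Not at hlt
  have hb0 : x' + (0 : ℝ) • u ∈ ball x ε₀ := by simpa using hb
  have h1 := hG.line1 x' u 0 hb0
  have h2 := h1.tendsto_slope_zero_right
  simp only [zero_smul, add_zero, zero_add, hG.zero_frontier hD.isOpen hx' hb, sub_zero] at h2
  have h3 := h2.eventually_const_lt hlt
  have h4 : ∀ᶠ t : ℝ in nhdsWithin 0 (Ioi 0), x' + t • u ∈ ball x ε₀ := by
    refine Filter.Eventually.filter_mono nhdsWithin_le_nhds ?_
    exact (line_deriv x' u 0).continuousAt.eventually (isOpen_ball.mem_nhds hb0)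
  obtain ⟨t, ⟨ht3, ht4⟩, ht⟩ := ((h3.and h4).and self_mem_nhdsWithin).exists
  have ht0 : 0 < t := ht
  have hpos : 0 < G (x' + t • u) := by
    rw [smul_eq_mul] at ht3
    exact (pos_iff_pos_of_mul_pos ht3).1 (inv_pos.2 ht0)
  have hs := support_pos hD hx' ((hG.mem _ ht4).2 hpos)
  rw [add_sub_cancel_left, inner_smul_left, hu] at hs
  simp at hs

lemma GFun.grad_eq {d : ℕ} {D : Set (EuclideanSpace ℝ (Fin d))} {ε₀ η : ℝ}
    {n : EuclideanSpace ℝ (Fin d) → EuclideanSpace ℝ (Fin d)}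
    (hD : AssumptionD d D ε₀ η n) {M : ℝ}
    {x nx : EuclideanSpace ℝ (Fin d)} {G G' G''} (hG : GFun D ε₀ M x nx G G' G'')
    {x' : EuclideanSpace ℝ (Fin d)} (hx' : x' ∈ frontier D)
    (hb : x' ∈ ball x ε₀) (v : EuclideanSpace ℝ (Fin d)) :
    G' x' v = G' x' (n x') * ⟪v, n x'⟫ := by
  have hn := hD.normal_norm x' hx'
  have h0 : ⟪v - ⟪v, n x'⟫ • n x', n x'⟫ = 0 := by
    rw [inner_sub_left, inner_smul_left, real_inner_self_eq_norm_sq, hn]; simp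
  have h1 := GFun.grad_le hD hG hx' hb _ h0
  have h2 := GFun.grad_le hD hG hx' hb (-(v - ⟪v, n x'⟫ • n x')) (by rw [inner_neg_left, h0, neg_zero])
  rw [map_neg] at h2
  rw [map_sub, map_smul, smul_eq_mul] at h1 h2
  linarith


lemma second_diff {d : ℕ} (T T' : EuclideanSpace ℝ (Fin d) →L[ℝ] EuclideanSpace ℝ (Fin d) →L[ℝ] ℝ)
    (a a' : EuclideanSpace ℝ (Fin d)) (M ρ l N : ℝ) (hρ : 0 ≤ ρ) (hN : 0 ≤ N)
    (hM : 0 ≤ M)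
    (hT : ‖T‖ ≤ M) (hTT : ‖T' - T‖ ≤ M * (2 * ρ)) (ha : ‖a‖ = N) (ha' : ‖a'‖ = N)
    (haa : ‖a' - a‖ ≤ ρ * N) (hl : |l - 1| ≤ (M + 1) * ρ) :
    |T' a' a' - l * T a a| ≤ M * (M + 5) * ρ * N ^ 2 := by
  have e : T' a' a' - l * T a a = (T' - T) a' a' + T (a' - a) a' + T a (a' - a)
      - (l - 1) * T a a := by
    simp only [map_sub, ContinuousLinearMap.sub_apply]; ring
  have h1 : |(T' - T) a' a'| ≤ M * (2 * ρ) * N * N := by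
    rw [← Real.norm_eq_abs]
    refine (ContinuousLinearMap.le_opNorm₂ _ _ _).trans ?_
    rw [ha']; gcongr
  have h2 : |T (a' - a) a'| ≤ M * (ρ * N) * N := by
    rw [← Real.norm_eq_abs]
    refine (ContinuousLinearMap.le_opNorm₂ _ _ _).trans ?_
    rw [ha']; gcongr
  have h3 : |T a (a' - a)| ≤ M * N * (ρ * N) := by
    rw [← Real.norm_eq_abs]
    refine (ContinuousLinearMap.le_opNorm₂ _ _ _).trans ?_
    rw [ha]; gcongr
  have h4 : |(l - 1) * T a a| ≤ (M + 1) * ρ * (M * N * N) := by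
    rw [abs_mul]
    have : |T a a| ≤ M * N * N := by
      rw [← Real.norm_eq_abs]
      refine (ContinuousLinearMap.le_opNorm₂ _ _ _).trans ?_
      rw [ha]; gcongr
    gcongr
  rw [e]
  have i1 := abs_sub ((T' - T) a' a' + T (a' - a) a' + T a (a' - a)) ((l - 1) * T a a)
  have i2 := abs_add_le ((T' - T) a' a' + T (a' - a) a') (T a (a' - a))
  have i3 := abs_add_le ((T' - T) a' a') (T (a' - a) a')
  nlinarith

lemma geo_iii {d : ℕ} {D : Set (EuclideanSpace ℝ (Fin d))} {ε₀ η : ℝ}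
    {n : EuclideanSpace ℝ (Fin d) → EuclideanSpace ℝ (Fin d)}
    (hD : AssumptionD d D ε₀ η n) {x x' : EuclideanSpace ℝ (Fin d)} (hx : x ∈ frontier D)
    (hx' : x' ∈ frontier D) (a a' : EuclideanSpace ℝ (Fin d)) (ρ N : ℝ)
    (ha : ‖a‖ = N) (ha' : ‖a'‖ = N) (haa : ‖a' - a‖ ≤ ρ * N) (hxx : ‖x' - x‖ + ‖n x' - n x‖ ≤ ρ)
    (hin : ⟪a, n x⟫ = ⟪a', n x'⟫) (hN : N < ε₀ / 4) (hρ1 : ρ < ε₀ / 4)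
    (hρ2 : (η⁻¹ + 1) * ρ < 1 / 2) (h1 : x + a ∉ D) (h2 : x' + a' ∈ D) :
    infDist (x' + a') Dᶜ ≤ η⁻¹ * (η⁻¹ + 5) * ρ * N ^ 2 := by
  obtain ⟨G, G', G'', hG⟩ := geoG hD x hx
  have hε := hD.eps_pos
  have hε1 := hD.eps_lt_one
  have hn := hD.normal_norm x hx
  have hn' := hD.normal_norm x' hx'
  have hM : 0 < η⁻¹ := inv_pos.2 hD.eta_pos
  generalize η⁻¹ = M at *
  have hN0 : 0 ≤ N := ha ▸ norm_nonneg _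
  have p1 := norm_nonneg (x' - x)
  have p2 := norm_nonneg (n x' - n x)
  have hρ0 : 0 ≤ ρ := by linarith
  have hbx : ∀ t ∈ Icc (0 : ℝ) 1, x + t • a ∈ ball x ε₀ := by
    intro t ht
    rw [mem_ball, dist_eq_norm, add_sub_cancel_left, norm_smul, Real.norm_eq_abs,
      abs_of_nonneg ht.1, ha]
    nlinarith [ht.1, ht.2]
  have hbx2 : ∀ t ∈ Icc (0 : ℝ) 1, ‖x' + t • a' - x‖ < ε₀ / 2 := by
    intro t ht
    have e : x' + t • a' - x = (x' - x) + t • a' := by abel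
    have := norm_add_le (x' - x) (t • a')
    rw [norm_smul, Real.norm_eq_abs, abs_of_nonneg ht.1, ha'] at this
    rw [e]
    nlinarith [ht.1, ht.2]
  have hbx' : ∀ t ∈ Icc (0 : ℝ) 1, x' + t • a' ∈ ball x ε₀ := by
    intro t ht
    rw [mem_ball, dist_eq_norm]; linarith [hbx2 t ht]
  have hx'b : x' ∈ ball x ε₀ := by simpa using hbx' 0 (by simp)
  have hxb : x ∈ ball x ε₀ := mem_ball_self hε
  set l := G' x' (n x') with hl
  have hl1 : |l - 1| ≤ (M + 1) * ρ := by
    have e : l - 1 = (G' x' - G' x) (n x') + ⟪n x' - n x, n x⟫ := by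
      rw [ContinuousLinearMap.sub_apply, hG.g1, inner_sub_left, real_inner_self_eq_norm_sq, hn]
      ring
    have q1 : ‖G' x' - G' x‖ ≤ M * ‖x' - x‖ :=
      Convex.norm_image_sub_le_of_norm_hasFDerivWithin_le (s := ball x ε₀)
        (fun w hw => (hG.d2 w hw).hasFDerivWithinAt) hG.b2 (convex_ball _ _) hxb hx'b
    have q2 : |(G' x' - G' x) (n x')| ≤ M * ‖x' - x‖ := by
      rw [← Real.norm_eq_abs]
      refine (ContinuousLinearMap.le_opNorm _ _).trans ?_
      rw [hn', mul_one]; exact q1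
    have q3 := abs_real_inner_le_norm (n x' - n x) (n x)
    rw [hn, mul_one] at q3
    rw [e]
    refine (abs_add_le _ _).trans ?_
    nlinarith
  have hlpos : 0 < l := by
    have := (abs_le.1 hl1).1; linarith
  have key := scalar_taylor (fun t => G (x' + t • a') - l * G (x + t • a))
    (fun t => G' (x' + t • a') a' - l * G' (x + t • a) a)
    (fun t => G'' (x' + t • a') a' a' - l * G'' (x + t • a) a a) (M * (M + 5) * ρ * N ^ 2)
    (fun t ht => (hG.line1 x' a' t (hbx' t ht)).sub ((hG.line1 x a t (hbx t ht)).const_mul l))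
    (fun t ht => (hG.line2 x' a' t (hbx' t ht)).sub ((hG.line2 x a t (hbx t ht)).const_mul l))
    (fun t ht => by
      refine second_diff _ _ a a' M ρ l N hρ0 hN0 hM.le (hG.b2 _ (hbx t ht)) ?_ ha ha' haa hl1
      refine (hG.l2 _ (hbx' t ht) _ (hbx t ht)).trans ?_
      refine mul_le_mul_of_nonneg_left ?_ hM.le
      have e : x' + t • a' - (x + t • a) = (x' - x) + t • (a' - a) := by
        rw [smul_sub]; abel
      rw [e]
      refine (norm_add_le _ _).trans ?_
      rw [norm_smul, Real.norm_eq_abs, abs_of_nonneg ht.1]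
      have : t * ‖a' - a‖ ≤ 1 * (ρ * 1) :=
        mul_le_mul ht.2 (haa.trans (mul_le_mul_of_nonneg_left (by linarith) hρ0))
          (norm_nonneg _) zero_le_one
      linarith)
    (by simp [hG.g0, hG.zero_frontier hD.isOpen hx' hx'b])
    (by
      simp only [zero_smul, add_zero]
      rw [GFun.grad_eq hD hG hx' hx'b a', hG.g1, hin]; ring)
  simp only [one_smul] at key
  have hb1 : x + a ∈ ball x ε₀ := by simpa using hbx 1 (by simp)
  have hb1' : x' + a' ∈ ball x ε₀ := by simpa using hbx' 1 (by simp)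
  have hh : ‖x' + a' - x‖ < ε₀ / 2 := by simpa using hbx2 1 (by simp)
  have g1 : G (x + a) ≤ 0 := not_lt.1 (fun h => h1 ((hG.mem _ hb1).2 h))
  have g2 : 0 < G (x' + a') := (hG.mem _ hb1').1 h2
  have g3 : G (x' + a') ≤ M * (M + 5) * ρ * N ^ 2 := by
    have := (abs_le.1 key).2
    nlinarith
  refine le_trans ?_ g3
  set s := G (x' + a') with hs
  have g4 : s ≤ ‖x' + a' - x‖ := (hG.le _ hb1').trans (inner_le_norm_unit _ _ hn)
  have hmem : x' + a' - s • n x ∈ Dᶜ := by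
    intro hm
    have hb : x' + a' - s • n x ∈ ball x ε₀ := by
      rw [mem_ball, dist_eq_norm]
      have e : x' + a' - s • n x - x = (x' + a' - x) - s • n x := by abel
      rw [e]
      refine (norm_sub_le _ _).trans_lt ?_
      rw [norm_smul, hn, Real.norm_eq_abs, abs_of_pos g2]
      linarith
    have := (hG.mem _ hb).1 hm
    rw [hG.tr] at this
    linarith
  refine (infDist_le_dist_of_mem hmem).trans (le_of_eq ?_)
  rw [dist_eq_norm, sub_sub_cancel, norm_smul, hn, Real.norm_eq_abs, abs_of_pos g2, mul_one]

lemma geo {d : ℕ} {D : Set (EuclideanSpace ℝ (Fin d))} {ε₀ η : ℝ}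
    {n : EuclideanSpace ℝ (Fin d) → EuclideanSpace ℝ (Fin d)}
    (hD : AssumptionD d D ε₀ η n) : ∃ C : ℝ, 0 < C ∧
      ∀ x ∈ frontier D, ∀ x' ∈ frontier D,
      ∀ A : EuclideanSpace ℝ (Fin d) →ₗᵢ[ℝ] EuclideanSpace ℝ (Fin d), A (e1 d) = n x →
      ∀ A' : EuclideanSpace ℝ (Fin d) →ₗᵢ[ℝ] EuclideanSpace ℝ (Fin d), A' (e1 d) = n x' →
      ∀ z, x' + A' z ∈ D → x + A z ∉ D → infDist (x' + A' z) Dᶜ ≤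
        C * (‖x - x'‖ + ‖A.toContinuousLinearMap - A'.toContinuousLinearMap‖) * ‖z‖ ^ 2 := by
  have hε := hD.eps_pos
  have hε1 := hD.eps_lt_one
  have hM : 0 < η⁻¹ := inv_pos.2 hD.eta_pos
  set M := η⁻¹ with hMdef
  set ε₂ := min (ε₀ / 4) (1 / (2 * (M + 1))) with hε₂
  have hε₂0 : 0 < ε₂ := by positivity
  have hc1 : 0 < 16 / ε₀ ^ 2 + 4 / ε₀ := by positivity
  have hc2 : 0 < (1 / ε₀ + M) / ε₂ := by positivity
  have hc3 : 0 < M * (M + 5) := by positivity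
  refine ⟨(16 / ε₀ ^ 2 + 4 / ε₀) + (1 / ε₀ + M) / ε₂ + M * (M + 5), by positivity, ?_⟩
  intro x hx x' hx' A hA A' hA' z hz' hz
  have hn := hD.normal_norm x hx
  have hn' := hD.normal_norm x' hx'
  set Δ := ‖A.toContinuousLinearMap - A'.toContinuousLinearMap‖ with hΔ
  have hΔ0 : 0 ≤ Δ := norm_nonneg _
  have hop : ∀ v, ‖A' v - A v‖ ≤ Δ * ‖v‖ := by
    intro v
    have := (A.toContinuousLinearMap - A'.toContinuousLinearMap).le_opNorm v
    rw [norm_sub_rev]; exact this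
  have hxr : ‖x' - x‖ = ‖x - x'‖ := norm_sub_rev _ _
  have hx0 := norm_nonneg (x - x')
  set ρ := ‖x - x'‖ + Δ with hρ
  have hρ0 : 0 ≤ ρ := by positivity
  have hzn := norm_nonneg z
  have hin : ⟪A z, n x⟫ = ⟪A' z, n x'⟫ := by
    rw [← hA, ← hA', LinearIsometry.inner_map_map, LinearIsometry.inner_map_map]
  have hq : 0 ≤ ρ * ‖z‖ ^ 2 := by positivity
  have fin : ∀ c, c ≤ (16 / ε₀ ^ 2 + 4 / ε₀) + (1 / ε₀ + M) / ε₂ + M * (M + 5) →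
      infDist (x' + A' z) Dᶜ ≤ c * (ρ * ‖z‖ ^ 2) → infDist (x' + A' z) Dᶜ ≤
      ((16 / ε₀ ^ 2 + 4 / ε₀) + (1 / ε₀ + M) / ε₂ + M * (M + 5)) * ρ * ‖z‖ ^ 2 := by
    intro c hc h
    rw [mul_assoc]
    exact h.trans (mul_le_mul_of_nonneg_right hc hq)
  rcases le_or_gt (ε₀ / 4) ‖z‖ with hb | hb
  · refine fin (16 / ε₀ ^ 2 + 4 / ε₀) (by linarith) ?_
    have hm : x + A z ∈ Dᶜ := hz
    refine (infDist_le_dist_of_mem hm).trans ?_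
    have e : x' + A' z - (x + A z) = (x' - x) + (A' z - A z) := by abel
    rw [dist_eq_norm, e]
    refine (norm_add_le _ _).trans ?_
    have h1 := hop z
    have h2 : ‖x' - x‖ + ‖A' z - A z‖ ≤ ρ * (1 + ‖z‖) := by
      rw [hxr, hρ]; nlinarith
    refine h2.trans ?_
    have h3 : 1 ≤ 16 / ε₀ ^ 2 * ‖z‖ ^ 2 := by
      rw [div_mul_eq_mul_div, le_div_iff₀ (by positivity)]; nlinarith
    have h4 : ‖z‖ ≤ 4 / ε₀ * ‖z‖ ^ 2 := by
      rw [div_mul_eq_mul_div, le_div_iff₀ hε]; nlinarith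
    have : ρ * (1 + ‖z‖) ≤ ρ * (16 / ε₀ ^ 2 * ‖z‖ ^ 2 + 4 / ε₀ * ‖z‖ ^ 2) :=
      mul_le_mul_of_nonneg_left (by linarith) hρ0
    linarith
  rcases le_or_gt ε₂ ρ with hr | hr
  · refine fin ((1 / ε₀ + M) / ε₂) (by linarith) ?_
    have hf := flat hD hx hz
    rw [add_sub_cancel_left, LinearIsometry.norm_map, hin] at hf
    have hp := support_pos hD hx' hz'
    rw [add_sub_cancel_left] at hp
    set s := ⟪A' z, n x'⟫ with hs
    have hm : x' + A' z - s • n x' ∈ Dᶜ := by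
      intro hm
      have := support_pos hD hx' hm
      have e : x' + A' z - s • n x' - x' = A' z - s • n x' := by abel
      rw [e, inner_sub_left, inner_smul_left, real_inner_self_eq_norm_sq, hn', ← hs] at this
      simp at this
    have h1 : infDist (x' + A' z) Dᶜ ≤ s := by
      refine (infDist_le_dist_of_mem hm).trans (le_of_eq ?_)
      rw [dist_eq_norm, sub_sub_cancel, norm_smul, hn', Real.norm_eq_abs, abs_of_pos hp, mul_one]
    refine (h1.trans hf).trans ?_
    rw [div_mul_eq_mul_div, le_div_iff₀ hε₂0]
    have : (1 / ε₀ + M) * ‖z‖ ^ 2 * ε₂ ≤ (1 / ε₀ + M) * ‖z‖ ^ 2 * ρ :=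
      mul_le_mul_of_nonneg_left hr (by positivity)
    linarith
  · refine fin (M * (M + 5)) (by linarith) ?_
    have := geo_iii hD hx hx' (A z) (A' z) ρ ‖z‖ (A.norm_map z) (A'.norm_map z)
      ((hop z).trans (by rw [hρ]; nlinarith))
      (by
        have := hop (e1 d)
        rw [e1_norm d hD.dim_ge, hA, hA'] at this
        rw [hxr, hρ]; linarith) hin hb (hr.trans_le (min_le_left _ _))
      (by
        have h5 := hr.trans_le (min_le_right _ _)
        rw [lt_div_iff₀ (by positivity)] at h5
        change (M + 1) * ρ < 1 / 2
        linarith) hz hz'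
    linarith


lemma exists_consts {d : ℕ} {D : Set (EuclideanSpace ℝ (Fin d))} {ε₀ η : ℝ}
    {n : EuclideanSpace ℝ (Fin d) → EuclideanSpace ℝ (Fin d)}
    (hD : AssumptionD d D ε₀ η n) : ∃ r R : ℝ, ∀ x ∈ frontier D,
      ∀ A : EuclideanSpace ℝ (Fin d) →ₗᵢ[ℝ] EuclideanSpace ℝ (Fin d),
        GoodSet {y | x + A y ∈ D} r R := by
  obtain ⟨c, hc⟩ := hD.nonempty
  obtain ⟨r, hr, hrD⟩ := Metric.isOpen_iff.1 hD.isOpen c hc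
  obtain ⟨B, hB⟩ := hD.isBounded.subset_closedBall (0 : EuclideanSpace ℝ (Fin d))
  have hBc : closure D ⊆ closedBall 0 B := closure_minimal hB isClosed_closedBall
  have hB0 : 0 ≤ B := (norm_nonneg c).trans (mem_closedBall_zero_iff.1 (hB hc))
  refine ⟨r, 2 * B + 1 + r, fun x hx A => ?_⟩
  have hcont : Continuous fun y => x + A y := continuous_const.add A.continuous
  have hxc := frontier_subset_closure hx
  have hsurj : Function.Surjective A := (A.toLinearIsometryEquiv rfl).surjective
  refine ⟨hD.isOpen.preimage hcont, ?_, ?_, hr, by linarith, ?_, ?_, ?_⟩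
  · intro y hy z hz a b ha hb hab
    have h1 := hD.convex hy hz ha hb hab
    have e : x + A (a • y + b • z) = a • (x + A y) + b • (x + A z) := by
      rw [map_add, map_smul, map_smul, smul_add, smul_add]
      have : x = a • x + b • x := by rw [← add_smul, hab, one_smul]
      nth_rewrite 1 [this]; abel
    change x + A (a • y + b • z) ∈ D
    rw [e]; exact h1
  · intro y hy
    have h1 := mem_closedBall_zero_iff.1 (hB hy)
    have h2 := mem_closedBall_zero_iff.1 (hBc hxc)
    rw [mem_ball_zero_iff]
    have h3 := norm_sub_le (x + A y) x
    rw [add_sub_cancel_left, A.norm_map] at h3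
    linarith
  · obtain ⟨c', hc'⟩ := hsurj (c - x)
    refine ⟨c', fun y hy => hrD ?_⟩
    rw [mem_ball, dist_eq_norm] at hy ⊢
    have e : x + A y - c = A (y - c') := by rw [map_sub, hc']; abel
    rw [e, A.norm_map]; exact hy
  · rw [Metric.mem_closure_iff] at hxc ⊢
    intro ε hε
    obtain ⟨b, hb, hdb⟩ := hxc ε hε
    obtain ⟨y, hy⟩ := hsurj (b - x)
    refine ⟨y, ?_, ?_⟩
    · change x + A y ∈ D
      rw [hy, add_sub_cancel]; exact hb
    · rw [dist_eq_norm, zero_sub, norm_neg, ← A.norm_map, hy, ← dist_eq_norm, dist_comm]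
      exact hdb
  · change x + A 0 ∉ D
    rw [map_zero, add_zero]; exact frontier_not_mem hD.isOpen hx

lemma compl_nonempty {d : ℕ} {D : Set (EuclideanSpace ℝ (Fin d))} (ho : IsOpen D)
    {x : EuclideanSpace ℝ (Fin d)} (hx : x ∈ frontier D) : (Dᶜ).Nonempty :=
  ⟨x, frontier_not_mem ho hx⟩

lemma infDist_frontier {d : ℕ} {D : Set (EuclideanSpace ℝ (Fin d))} (ho : IsOpen D)
    {x w : EuclideanSpace ℝ (Fin d)} (hx : x ∈ frontier D) (hw : w ∈ D) :
    infDist w (frontier D) = infDist w Dᶜ := by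
  apply le_antisymm
  · obtain ⟨y, hy, he⟩ := exists_mem_frontier_infDist_compl_eq_dist (x := w) (s := D) hw
      (fun h => frontier_not_mem ho hx (h ▸ mem_univ x))
    rw [he]; exact infDist_le_dist_of_mem hy
  · exact infDist_le_infDist_of_subset (fun y hy => frontier_not_mem ho hy) ⟨x, hx⟩

lemma infDist_transfer {d : ℕ} {D : Set (EuclideanSpace ℝ (Fin d))}
    (x y : EuclideanSpace ℝ (Fin d))
    (A : EuclideanSpace ℝ (Fin d) →ₗᵢ[ℝ] EuclideanSpace ℝ (Fin d)) :
    infDist y {y | x + A y ∈ D}ᶜ = infDist (x + A y) Dᶜ := by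
  have hsurj : Function.Surjective A := (A.toLinearIsometryEquiv rfl).surjective
  have hiso : Isometry (fun y => x + A y) := by
    apply Isometry.of_dist_eq
    intro a b
    rw [dist_add_left, A.dist_map]
  have him : (fun y => x + A y) '' {y | x + A y ∈ D}ᶜ = Dᶜ := by
    ext w
    constructor
    · rintro ⟨y, hy, rfl⟩; exact hy
    · intro hw
      obtain ⟨y, hy⟩ := hsurj (w - x)
      have e : x + A y = w := by rw [hy, add_sub_cancel]
      refine ⟨y, ?_, e⟩
      intro h
      change x + A y ∈ D at h
      rw [e] at h; exact hw h
  rw [← him]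
  exact (infDist_image hiso).symm

lemma set_ite {d : ℕ} (H P : Set (EuclideanSpace ℝ (Fin d))) (hP : MeasurableSet P)
    (g : EuclideanSpace ℝ (Fin d) → ℝ) (Q : EuclideanSpace ℝ (Fin d) → Prop)
    [DecidablePred Q] (hQ : ∀ z, Q z ↔ z ∈ P) :
    ∫⁻ z in H, ENNReal.ofReal (if Q z then g z else 0) = ∫⁻ z in P ∩ H, ENNReal.ofReal (g z) := by
  have : (fun z => ENNReal.ofReal (if Q z then g z else 0)) =
      P.indicator (fun z => ENNReal.ofReal (g z)) := by
    ext z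
    by_cases hz : z ∈ P <;> simp [hz, hQ]
  rw [this, lintegral_indicator hP, Measure.restrict_restrict hP]

/-- integral estimates: under Assumption (D), for `α ∈ (0,2)` and
`β ∈ (0,1)` there is `C > 0` such that for all `x, x' ∈ ∂D`, `A ∈ I_x`, `A' ∈ I_{x'}`,
writing `ρ = |x−x'| + ‖A−A'‖` and `δ(w) = dist(w,∂D)`, the four Lebesgue integrals
(1)–(4) of the statement are bounded by `C`, `Cρ`, `C` and `Cρ` respectively. -/
theorem stmt_16 (d : ℕ) (D : Set (EuclideanSpace ℝ (Fin d))) (ε₀ η : ℝ)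
    (n : EuclideanSpace ℝ (Fin d) → EuclideanSpace ℝ (Fin d))
    (hD : AssumptionD d D ε₀ η n) (α β : ℝ)
    (hα : α ∈ Set.Ioo (0 : ℝ) 2) (hβ : β ∈ Set.Ioo (0 : ℝ) 1) :
    ∃ C : ℝ, 0 < C ∧
      ∀ x ∈ frontier D, ∀ x' ∈ frontier D,
      ∀ A : EuclideanSpace ℝ (Fin d) →ₗᵢ[ℝ] EuclideanSpace ℝ (Fin d), A (e1 d) = n x →
      ∀ A' : EuclideanSpace ℝ (Fin d) →ₗᵢ[ℝ] EuclideanSpace ℝ (Fin d), A' (e1 d) = n x' →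
        ((∫⁻ y : EuclideanSpace ℝ (Fin d), ∫⁻ z : EuclideanSpace ℝ (Fin d),
            ENNReal.ofReal (if x + A y ∈ D ∧ x + A z ∉ D then
              (min ‖z‖ 1 + ‖y‖ * min ‖y - z‖ 1 / Metric.infDist (x + A y) (frontier D)) *
                Metric.infDist (x + A y) (frontier D) ^ (α / 2) /
                  (‖z - y‖ ^ ((d : ℝ) + α) * ‖y‖ ^ (d : ℝ))
              else 0))
          ≤ ENNReal.ofReal C) ∧
        ((∫⁻ y : EuclideanSpace ℝ (Fin d), ∫⁻ z : EuclideanSpace ℝ (Fin d),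
            ENNReal.ofReal (if x + A y ∈ D ∧ x + A z ∉ D ∧ x' + A' z ∈ D then
              Metric.infDist (x' + A' z) (frontier D) ^ (α / 2) *
                Metric.infDist (x + A y) (frontier D) ^ (α / 2) /
                  (‖z - y‖ ^ ((d : ℝ) + α) * ‖y‖ ^ (d : ℝ))
              else 0))
          ≤ ENNReal.ofReal (C *
              (‖x - x'‖ + ‖A.toContinuousLinearMap - A'.toContinuousLinearMap‖))) ∧
        ((∫⁻ z in {z : EuclideanSpace ℝ (Fin d) | 0 < ⟪z, e1 d⟫},
            ENNReal.ofReal (if x + A z ∉ D then ‖z‖ ^ (-(d : ℝ) - β) else 0))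
          ≤ ENNReal.ofReal C) ∧
        ((∫⁻ z in {z : EuclideanSpace ℝ (Fin d) | 0 < ⟪z, e1 d⟫},
            ENNReal.ofReal (if x + A z ∉ D ∧ x' + A' z ∈ D then ‖z‖ ^ (-(d : ℝ) - β) else 0))
          ≤ ENNReal.ofReal (C *
              (‖x - x'‖ + ‖A.toContinuousLinearMap - A'.toContinuousLinearMap‖))) := by
  obtain ⟨hα0, hα2⟩ := hα
  obtain ⟨hβ0, hβ1⟩ := hβ
  have hd := hD.dim_ge
  have ho := hD.isOpen
  have hflat : 0 < 1 / ε₀ + η⁻¹ := by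
    have := hD.eps_pos
    have := hD.eta_pos
    positivity
  obtain ⟨r, R, hgood⟩ := exists_consts hD
  obtain ⟨Cg, hCg, hgeo⟩ := geo hD
  obtain ⟨C1, hC1, h1⟩ := part1 d hd r R α hα0 hα2
  obtain ⟨C2, hC2, h2⟩ := part2 d hd r R α hα0 hα2
  obtain ⟨C3, hC3, h3⟩ := part3 d hd (e1 d) (e1_norm d hd) (1 / ε₀ + η⁻¹) β hflat hβ0 hβ1
  obtain ⟨C4, hC4, h4⟩ := part4 d hd r R β hβ0 hβ1
  have hC2g : 0 < C2 * Cg := mul_pos hC2 hCg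
  have hC4g : 0 < C4 * Cg := mul_pos hC4 hCg
  refine ⟨C1 + C2 * Cg + C3 + C4 * Cg, by positivity, ?_⟩
  intro x hx x' hx' A hA A' hA'
  have hU := hgood x hx A
  have hU' := hgood x' hx' A'
  have hg := hgeo x hx x' hx' A hA A' hA'
  set ρ := ‖x - x'‖ + ‖A.toContinuousLinearMap - A'.toContinuousLinearMap‖ with hρ
  have hρ0 : 0 ≤ ρ := by positivity
  have hδ : ∀ y, x + A y ∈ D → infDist (x + A y) (frontier D) = infDist y {y | x + A y ∈ D}ᶜ :=
    fun y hy => by rw [infDist_frontier ho hx hy, infDist_transfer]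
  have hδ' : ∀ y, x' + A' y ∈ D →
      infDist (x' + A' y) (frontier D) = infDist y {y | x' + A' y ∈ D}ᶜ :=
    fun y hy => by rw [infDist_frontier ho hx hy, infDist_transfer]
  have hg' : ∀ z ∈ {y | x' + A' y ∈ D}, z ∉ {y | x + A y ∈ D} →
      infDist z {y | x' + A' y ∈ D}ᶜ ≤ Cg * ρ * ‖z‖ ^ 2 := by
    intro z hz' hz
    rw [infDist_transfer]; exact hg z hz' hz
  have hzero : ρ = 0 → ∀ z, x' + A' z ∈ D → x + A z ∉ D → False := by
    intro h0 z hz' hz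
    have h5 := hg z hz' hz
    rw [h0, mul_zero, zero_mul] at h5
    have h6 : 0 < infDist (x' + A' z) Dᶜ :=
      (ho.isClosed_compl.notMem_iff_infDist_pos (compl_nonempty ho hx)).1 (fun h => h hz')
    linarith
  have hexp : -(d : ℝ) - β = -(d + β) := by ring
  refine ⟨?_, ?_, ?_, ?_⟩
  · refine le_trans (le_of_eq ?_) ((h1 _ hU).trans (ENNReal.ofReal_le_ofReal (by linarith)))
    refine lintegral_congr fun y => lintegral_congr fun z => ?_
    by_cases hy : x + A y ∈ D
    · rw [hδ y hy]; rfl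
    · rw [if_neg (fun h => hy h.1), if_neg (fun h => hy h.1)]
  · rcases hρ0.eq_or_lt with h0 | h0
    · refine le_trans (le_of_eq ?_) zero_le
      rw [← lintegral_zero]
      refine lintegral_congr fun y => ?_
      rw [← lintegral_zero]
      refine lintegral_congr fun z => ?_
      rw [if_neg (fun h => hzero h0.symm z h.2.2 h.2.1), ENNReal.ofReal_zero]
    · refine le_trans (le_of_eq ?_) ((h2 _ _ hU hU' (Cg * ρ) (mul_pos hCg h0) hg').trans
        (ENNReal.ofReal_le_ofReal ?_))
      · refine lintegral_congr fun y => lintegral_congr fun z => ?_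
        by_cases hy : x + A y ∈ D ∧ x + A z ∉ D ∧ x' + A' z ∈ D
        · rw [hδ y hy.1, hδ' z hy.2.2]; rfl
        · rw [if_neg hy]
          exact (congrArg ENNReal.ofReal (if_neg hy)).symm
      · rw [← mul_assoc]
        exact mul_le_mul_of_nonneg_right (by linarith) hρ0
  · have hm : MeasurableSet {y | x + A y ∈ D}ᶜ := hU.op.measurableSet.compl
    have h5 := set_ite {z : EuclideanSpace ℝ (Fin d) | 0 < ⟪z, e1 d⟫} {y | x + A y ∈ D}ᶜ hm
      (fun z => ‖z‖ ^ (-(d : ℝ) - β)) (fun z => x + A z ∉ D) (fun z => Iff.rfl)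
    refine (le_of_eq h5).trans ?_
    rw [inter_comm, hexp]
    refine (h3 _ hU.op ?_).trans (ENNReal.ofReal_le_ofReal (by linarith))
    intro z hz
    have h6 := flat hD hx (w := x + A z) hz
    rw [add_sub_cancel_left, A.norm_map, ← hA, A.inner_map_map] at h6
    exact h6
  · have hm : MeasurableSet ({y | x + A y ∈ D}ᶜ ∩ {y | x' + A' y ∈ D}) :=
      hU.op.measurableSet.compl.inter hU'.op.measurableSet
    have h5 := set_ite {z : EuclideanSpace ℝ (Fin d) | 0 < ⟪z, e1 d⟫} _ hm
      (fun z => ‖z‖ ^ (-(d : ℝ) - β)) (fun z => x + A z ∉ D ∧ x' + A' z ∈ D) (fun z => Iff.rfl)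
    refine (le_of_eq h5).trans ?_
    rcases hρ0.eq_or_lt with h0 | h0
    · have : ({y | x + A y ∈ D}ᶜ ∩ {y | x' + A' y ∈ D}) ∩
          {z : EuclideanSpace ℝ (Fin d) | 0 < ⟪z, e1 d⟫} = ∅ := by
        rw [eq_empty_iff_forall_notMem]
        intro z hz
        exact hzero h0.symm z hz.1.2 hz.1.1
      rw [this]; simp
    · rw [hexp]
      refine le_trans (lintegral_mono_set ?_) ((h4 _ _ hU hU' (Cg * ρ) (mul_pos hCg h0) hg').trans
        (ENNReal.ofReal_le_ofReal ?_))
      · intro z hz; exact ⟨hz.1.2, hz.1.1⟩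
      · rw [← mul_assoc]
        exact mul_le_mul_of_nonneg_right (by linarith) hρ0
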